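/- arXiv:math/0404524 — 3 statements merged into one kernel-verified Lean document; each statement's English description precedes it below -/
import Mathlib

section
/- Let σ be fixed with 1 < σ ≤ 3/2. Then for every ε > 0 and all T ≥ 2, ∫_1^T |K(σ+it)|² dt ≪_{σ,ε} T^{(33−18σ)/5+ε}. -/
open MeasureTheory Complex

lemma ft_cont {D : ℝ → ℝ} {μ : Measure ℝ} (hD : Integrable D μ) :
    Continuous (fun t : ℝ => ∫ u, (D u : ℂ) * cexp (-(I * t * u)) ∂μ) := by
  refine continuous_of_dominated (bound := fun u => ‖D u‖) ?_ ?_ hD.norm ?_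
  · intro t
    exact (hD.ofReal.aestronglyMeasurable).mul (by fun_prop)
  · intro t
    refine Filter.Eventually.of_forall fun u => ?_
    have : -(I * t * u) = ((-(t*u) : ℝ) : ℂ) * I := by push_cast; ring
    rw [this, norm_mul, Complex.norm_exp_ofReal_mul_I]; simp
  · refine Filter.Eventually.of_forall fun u => ?_
    fun_prop

lemma gauss_conv {f k : ℝ → ℝ} (hf : Integrable f) (hk : Integrable k) :
    Integrable (fun p : ℝ × ℝ => f p.2 * k (p.1 - p.2)) ∧
    ∫ p : ℝ × ℝ, f p.2 * k (p.1 - p.2) = (∫ u, f u) * ∫ u, k u := by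
  have h1 := Integrable.convolution_integrand (ContinuousLinearMap.mul ℝ ℝ) hf hk
  have h2 := integral_convolution (ContinuousLinearMap.mul ℝ ℝ) hf hk
  simp only [ContinuousLinearMap.mul_apply'] at h1 h2
  refine ⟨h1, ?_⟩
  rw [← h2, Measure.volume_eq_prod, integral_prod _ h1]
  rfl

lemma gauss_conv' {f k : ℝ → ℝ} (hf : Integrable f) (hk : Integrable k) (hke : ∀ x, k (-x) = k x) :
    Integrable (fun p : ℝ × ℝ => f p.1 * k (p.1 - p.2)) ∧
    ∫ p : ℝ × ℝ, f p.1 * k (p.1 - p.2) = (∫ u, f u) * ∫ u, k u := by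
  obtain ⟨h1, h2⟩ := gauss_conv hf hk
  have e : (fun p : ℝ × ℝ => f p.1 * k (p.1 - p.2)) =
      (fun p : ℝ × ℝ => f p.2 * k (p.1 - p.2)) ∘ Prod.swap := by
    funext p
    simp only [Function.comp, Prod.fst_swap, Prod.snd_swap]
    rw [← hke (p.1 - p.2), neg_sub]
  constructor
  · rw [e]; exact h1.swap
  · rw [e, ← h2]
    exact integral_prod_swap (μ := (volume : Measure ℝ)) (ν := (volume : Measure ℝ)) (fun p : ℝ × ℝ => f p.2 * k (p.1 - p.2))

lemma bessel (D : ℝ → ℝ) (hD : Integrable D) (hD2 : Integrable (fun u => D u ^ 2))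
    (U : ℝ) (hU : 0 < U) :
    ∫ t in U..(2*U), ‖∫ u, (D u : ℂ) * cexp (-(I * t * u))‖ ^ 2
      ≤ Real.exp 4 * (2 * Real.pi) * ∫ u, D u ^ 2 := by
  set Φ : ℝ → ℂ := fun t => ∫ u, (D u : ℂ) * cexp (-(I * t * u)) with hΦ
  have hΦc : Continuous Φ := ft_cont hD
  have hUi : 0 < (1 / U^2 : ℝ) := by positivity
  set w : ℝ → ℝ := fun t => Real.exp (-(1 / U^2) * t ^ 2) with hw
  have hwi : Integrable w := integrable_exp_neg_mul_sq hUi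
  have hnorm1 : ∀ r : ℝ, ‖cexp ((r : ℂ) * I)‖ = 1 := Complex.norm_exp_ofReal_mul_I
  have hΦb : ∀ t, ‖Φ t‖ ≤ ∫ u, ‖D u‖ := by
    intro t
    refine (norm_integral_le_integral_norm _).trans (le_of_eq ?_)
    congr 1; funext u
    have : -(I * t * u) = ((-(t*u) : ℝ) : ℂ) * I := by push_cast; ring
    rw [norm_mul, this, hnorm1]; simp
  have hint : Integrable (fun t => ‖Φ t‖^2 * w t) := by
    refine hwi.bdd_mul (c := (∫ u, ‖D u‖)^2) (by fun_prop) ?_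
    refine Filter.Eventually.of_forall fun t => ?_
    rw [norm_pow, norm_norm]
    exact pow_le_pow_left₀ (norm_nonneg _) (hΦb t) 2
  have step1 : ∫ t in U..(2*U), ‖Φ t‖ ^ 2 ≤ Real.exp 4 * ∫ t, ‖Φ t‖^2 * w t := by
    have a1 : ∫ t in U..(2*U), ‖Φ t‖ ^ 2 ≤ ∫ t in U..(2*U), Real.exp 4 * (‖Φ t‖^2 * w t) := by
      apply intervalIntegral.integral_mono_on (by linarith)
      · exact (Continuous.intervalIntegrable (by fun_prop) _ _)
      · exact (Continuous.intervalIntegrable (by fun_prop) _ _)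
      · intro t ht
        have : 1 ≤ Real.exp 4 * w t := by
          rw [hw, ← Real.exp_add]
          apply Real.one_le_exp
          have : t^2 ≤ 4 * U^2 := by nlinarith [ht.1, ht.2]
          have : (1/U^2) * t^2 ≤ 4 := by
            rw [one_div, inv_mul_le_iff₀ (by positivity)]; linarith
          linarith
        nlinarith [sq_nonneg ‖Φ t‖]
    refine a1.trans ?_
    rw [intervalIntegral.integral_const_mul]
    gcongr
    rw [intervalIntegral.integral_of_le (by linarith)]
    apply setIntegral_le_integral hint
    refine Filter.Eventually.of_forall fun t => ?_
    positivity
  set k : ℝ → ℝ := fun r => (Real.sqrt Real.pi * U) * Real.exp (-(U^2/4) * r ^ 2) with hk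
  have hki : Integrable k := (integrable_exp_neg_mul_sq (by positivity)).const_mul _
  have hkI : ∫ r, k r = 2 * Real.pi := by
    rw [hk, integral_const_mul, integral_gaussian]
    have : Real.pi / (U^2/4) = (2/U)^2 * Real.pi := by field_simp; norm_num
    rw [this, Real.sqrt_mul (by positivity), Real.sqrt_sq (by positivity)]
    have := Real.mul_self_sqrt Real.pi_pos.le
    field_simp
    nlinarith
  have hkt : ∀ r : ℝ, ∫ t, ((w t : ℝ) : ℂ) * cexp (-(I * t * r)) = ((k r : ℝ) : ℂ) := by
    intro r
    have := fourierIntegral_gaussian (b := ((1/U^2 : ℝ) : ℂ)) (by rw [Complex.ofReal_re]; exact hUi) (-r : ℂ)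
    have e : ∀ t : ℝ, ((w t : ℝ) : ℂ) * cexp (-(I * t * r)) =
        cexp (I * (-r : ℂ) * t) * cexp (-((1/U^2 : ℝ) : ℂ) * (t:ℂ) ^ 2) := by
      intro t
      rw [hw, mul_comm]; push_cast; congr 2; ring
    rw [integral_congr_ae (Filter.Eventually.of_forall e), this]
    have c1 : ((Real.pi : ℂ) / ((1/U^2 : ℝ) : ℂ)) ^ (1/2 : ℂ) = ((Real.sqrt Real.pi * U : ℝ) : ℂ) := by
      have h1 : ((Real.pi : ℂ) / ((1/U^2 : ℝ) : ℂ)) = ((Real.pi * U^2 : ℝ) : ℂ) := by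
        push_cast; field_simp
      have h2 : Real.sqrt Real.pi * U = (Real.pi * U^2) ^ (1/2 : ℝ) := by
        rw [← Real.sqrt_eq_rpow, Real.sqrt_mul Real.pi_pos.le, Real.sqrt_sq hU.le]
      rw [h1, h2, Complex.ofReal_cpow (by positivity)]; norm_num
    rw [c1, hk]
    have : (U:ℂ) ≠ 0 := by exact_mod_cast hU.ne'
    push_cast
    congr 2
    field_simp
  -- square expansion
  have hsq : ∀ t : ℝ, ((‖Φ t‖^2 : ℝ) : ℂ) =
      ∫ p : ℝ × ℝ, ((D p.1 : ℂ) * cexp (-(I * t * p.1))) * ((D p.2 : ℂ) * cexp (I * t * p.2)) := by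
    intro t
    rw [Measure.volume_eq_prod, integral_prod_mul (fun u : ℝ => (D u : ℂ) * cexp (-(I * t * u))) (fun u : ℝ => (D u : ℂ) * cexp (I * t * u))]
    have : ∫ u, (D u : ℂ) * cexp (I * t * u) = (starRingEnd ℂ) (Φ t) := by
      rw [hΦ, ← integral_conj]
      congr 1; funext u
      rw [map_mul, ← Complex.exp_conj]; simp
    rw [this, Complex.mul_conj, Complex.normSq_eq_norm_sq]
  have hDD : Integrable (fun p : ℝ × ℝ => (D p.1 : ℂ) * (D p.2 : ℂ)) := hD.ofReal.mul_prod hD.ofReal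
  have hjoint : Integrable (Function.uncurry (fun (t : ℝ) (p : ℝ × ℝ) =>
      (((w t : ℝ) : ℂ) * ((D p.1 : ℂ) * (D p.2 : ℂ))) * cexp (-(I * t * (p.1 - p.2 : ℝ))))) := by
    have := (hwi.ofReal (𝕜 := ℂ)).mul_prod hDD
    refine this.mul_bdd (c := 1) ?_ ?_
    · apply Continuous.aestronglyMeasurable; fun_prop
    · refine Filter.Eventually.of_forall fun x => ?_
      have : -(I * x.1 * ((x.2.1 - x.2.2 : ℝ) : ℂ)) = ((-(x.1*(x.2.1 - x.2.2)) : ℝ) : ℂ) * I := by push_cast; ring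
      rw [this, hnorm1]
  have step2 : ((∫ t, ‖Φ t‖^2 * w t : ℝ) : ℂ) = ∫ p : ℝ × ℝ, ((D p.1 * D p.2 * k (p.1 - p.2) : ℝ) : ℂ) := by
    rw [← integral_complex_ofReal]
    have : ∀ t : ℝ, ((‖Φ t‖^2 * w t : ℝ) : ℂ) = ∫ p : ℝ × ℝ,
        (((w t : ℝ) : ℂ) * ((D p.1 : ℂ) * (D p.2 : ℂ))) * cexp (-(I * t * (p.1 - p.2 : ℝ))) := by
      intro t
      rw [Complex.ofReal_mul, hsq, mul_comm, ← integral_const_mul]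
      congr 1; funext p
      have : -(I * t * ((p.1 - p.2 : ℝ) : ℂ)) = -(I * t * p.1) + I * t * p.2 := by push_cast; ring
      rw [this, Complex.exp_add]; ring
    rw [integral_congr_ae (Filter.Eventually.of_forall this), integral_integral_swap hjoint]
    congr 1; funext p
    have := hkt (p.1 - p.2)
    push_cast at this ⊢
    rw [← this, ← integral_const_mul]
    congr 1; funext t
    ring
  have step3 : ∫ t, ‖Φ t‖^2 * w t ≤ (∫ u, D u ^ 2) * (2 * Real.pi) := by
    rw [integral_complex_ofReal] at step2
    have e2 := Complex.ofReal_injective step2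
    rw [e2]
    have hke : ∀ x, k (-x) = k x := by intro x; simp [hk]
    obtain ⟨i1, v1⟩ := gauss_conv hD2 hki
    obtain ⟨i2, v2⟩ := gauss_conv' hD2 hki hke
    have hk0 : ∀ x, 0 ≤ k x := by intro x; rw [hk]; positivity
    calc ∫ p : ℝ × ℝ, D p.1 * D p.2 * k (p.1 - p.2)
        ≤ ∫ p : ℝ × ℝ, (1/2 : ℝ) * (D p.1 ^ 2 * k (p.1 - p.2) + D p.2 ^ 2 * k (p.1 - p.2)) := by
          apply integral_mono ?_ ((i2.add i1).const_mul _) ?_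
          · refine (hD.mul_prod hD).mul_bdd (c := Real.sqrt Real.pi * U) ?_ ?_
            · apply Continuous.aestronglyMeasurable; fun_prop
            · refine Filter.Eventually.of_forall fun p => ?_
              rw [Real.norm_of_nonneg (hk0 _), hk]
              have : Real.exp (-(U^2/4) * (p.1 - p.2) ^ 2) ≤ 1 := by
                apply Real.exp_le_one_iff.2
                have : 0 ≤ (U^2/4) * (p.1 - p.2) ^ 2 := by positivity
                linarith
              exact mul_le_of_le_one_right (by positivity) this
          · intro p
            show D p.1 * D p.2 * k (p.1 - p.2) ≤ (1/2 : ℝ) * (D p.1 ^ 2 * k (p.1 - p.2) + D p.2 ^ 2 * k (p.1 - p.2))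
            nlinarith [mul_nonneg (sq_nonneg (D p.1 - D p.2)) (hk0 (p.1 - p.2))]
      _ = (∫ u, D u ^ 2) * (2 * Real.pi) := by
          rw [integral_const_mul, integral_add i2 i1, v1, v2, hkI]; ring
  nlinarith [Real.exp_pos 4]

lemma exp_int_le {θ : ℝ} (hθ : 0 < θ) (a L : ℝ) :
    ∫ u in a..L, Real.exp (θ * u) ≤ Real.exp (θ * L) / θ := by
  have : ∫ u in a..L, Real.exp (θ * u) = (Real.exp (θ * L) - Real.exp (θ * a)) / θ := by
    rw [intervalIntegral.integral_comp_mul_left (fun x => Real.exp x) hθ.ne', integral_exp, smul_eq_mul]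
    field_simp
  rw [this]
  gcongr
  linarith [Real.exp_pos (θ * a)]

lemma M_int (M : ℝ → ℝ) (hMc : Continuous M) (A a δ θ : ℝ) (hA : 1 ≤ A) (ha0 : 0 ≤ a) (ha1 : a ≤ 1)
    (hθ : 0 < θ) (hθe : θ = 1 + δ - a)
    (hM0 : ∀ u, 0 ≤ u → 0 ≤ M u) (hM1 : ∀ u, 0 ≤ u → M u ≤ A * Real.exp ((1 + δ) * u))
    (L h : ℝ) (hL : 1 ≤ L) (h0 : 0 < h) (h1 : h ≤ 1) :
    ∫ u in (0:ℝ)..(L - h), Real.exp (-a * u) * (M (u + h) - M u)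
      ≤ (3 * A / θ + A) * h * Real.exp (θ * L) := by
  set f : ℝ → ℝ := fun u => Real.exp (-a * u) * M u with hf
  have hfc : Continuous f := by fun_prop
  have ii : ∀ x y, IntervalIntegrable f volume x y := fun x y => hfc.intervalIntegrable _ _
  have hfb : ∀ u, 0 ≤ u → f u ≤ A * Real.exp (θ * u) := by
    intro u hu
    have : Real.exp (θ * u) = Real.exp (-a * u) * Real.exp ((1+δ) * u) := by
      rw [← Real.exp_add, hθe]; ring_nf
    rw [this, hf]
    have := mul_le_mul_of_nonneg_left (hM1 u hu) (Real.exp_pos (-a*u)).le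
    show Real.exp (-a * u) * M u ≤ _
    linarith
  have hf0 : ∀ u, 0 ≤ u → 0 ≤ f u := fun u hu => mul_nonneg (Real.exp_pos _).le (hM0 u hu)
  have e1 : ∫ u in (0:ℝ)..(L - h), Real.exp (-a * u) * (M (u + h) - M u)
      = Real.exp (a * h) * (∫ u in h..L, f u) - ∫ u in (0:ℝ)..(L-h), f u := by
    have : ∫ u in h..L, f u = ∫ u in (0:ℝ)..(L-h), f (u + h) := by
      rw [intervalIntegral.integral_comp_add_right]; simp
    rw [this, ← intervalIntegral.integral_const_mul, ← intervalIntegral.integral_sub]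
    · congr 1; funext u
      have : Real.exp (-a * u) = Real.exp (a * h) * Real.exp (-a * (u + h)) := by
        rw [← Real.exp_add]; ring_nf
      simp only [hf]
      rw [mul_sub, ← mul_assoc, ← this]
    · exact Continuous.intervalIntegrable (by fun_prop) _ _
    · exact ii _ _
  have e2 : (∫ u in h..L, f u) = (∫ u in (0:ℝ)..(L-h), f u) + (∫ u in (L-h)..L, f u) - ∫ u in (0:ℝ)..h, f u := by
    rw [intervalIntegral.integral_add_adjacent_intervals (ii _ _) (ii _ _)]
    rw [← intervalIntegral.integral_add_adjacent_intervals (ii 0 h) (ii h L)]; ring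
  have p1 : 0 ≤ ∫ u in (0:ℝ)..h, f u :=
    intervalIntegral.integral_nonneg h0.le (fun u hu => hf0 u hu.1)
  have p2 : ∫ u in (L-h)..L, f u ≤ h * (A * Real.exp (θ * L)) := by
    have : ∫ u in (L-h)..L, f u ≤ ∫ u in (L-h)..L, A * Real.exp (θ * L) := by
      apply intervalIntegral.integral_mono_on (by linarith) (ii _ _) (by simp)
      intro u hu
      refine (hfb u (by linarith [hu.1])).trans ?_
      gcongr
      exact hu.2
    refine this.trans (le_of_eq ?_)
    rw [intervalIntegral.integral_const, smul_eq_mul]; ring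
  have p3 : ∫ u in h..L, f u ≤ A * (Real.exp (θ * L) / θ) := by
    have : ∫ u in h..L, f u ≤ ∫ u in h..L, A * Real.exp (θ * u) := by
      apply intervalIntegral.integral_mono_on (by linarith) (ii _ _) (Continuous.intervalIntegrable (by fun_prop) _ _)
      intro u hu
      exact hfb u (by linarith [hu.1])
    refine this.trans ?_
    rw [intervalIntegral.integral_const_mul]
    exact mul_le_mul_of_nonneg_left (exp_int_le hθ _ _) (by linarith)
  have p4 : Real.exp (a * h) - 1 ≤ 3 * h := by
    have hah : a * h ≤ 1 := by nlinarith
    have hah' : a * h ≤ h := by nlinarith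
    have q1 : Real.exp (a*h) * (1 - a * h) ≤ 1 := by
      have := Real.add_one_le_exp (-(a*h))
      have h2 : Real.exp (a*h) * Real.exp (-(a*h)) = 1 := by rw [← Real.exp_add]; simp
      nlinarith [Real.exp_pos (a*h)]
    have q2 : Real.exp (a*h) ≤ 3 := by
      have := Real.exp_le_exp.2 hah
      have := Real.exp_one_lt_d9
      linarith
    have : 0 ≤ a * h := by positivity
    nlinarith
  have p5 : 0 ≤ ∫ u in h..L, f u :=
    intervalIntegral.integral_nonneg (by linarith) (fun u hu => hf0 u (by linarith [hu.1]))
  have p6 : (Real.exp (a * h) - 1) * (∫ u in h..L, f u) ≤ 3 * h * (A * (Real.exp (θ * L) / θ)) := by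
    have : 0 ≤ 3 * h := by linarith
    calc _ ≤ 3 * h * (∫ u in h..L, f u) := mul_le_mul_of_nonneg_right p4 p5
      _ ≤ _ := mul_le_mul_of_nonneg_left p3 this
  have : (3 * A / θ + A) * h * Real.exp (θ * L) = 3 * h * (A * (Real.exp (θ * L) / θ)) + h * (A * Real.exp (θ * L)) := by
    field_simp
  rw [e1, this]
  nlinarith

set_option maxHeartbeats 1000000 in
lemma diff_bound (e M : ℝ → ℝ) (he : Continuous e) (hMc : Continuous M) (A σ δ : ℝ) (hA : 1 ≤ A)
    (hσ1 : 1 < σ) (hσ2 : σ ≤ 3/2) (hδ : 0 < δ) (hδ2 : δ ≤ (σ - 1)/2)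
    (heb : ∀ u, 0 ≤ u → |e u| ≤ A * Real.exp ((2/3 + δ) * u))
    (hM0 : ∀ u, 0 ≤ u → 0 ≤ M u) (hM1 : ∀ u, 0 ≤ u → M u ≤ A * Real.exp ((1 + δ) * u))
    (hd : ∀ u v, 0 ≤ u → u ≤ v → |e v - e u| ≤ M v - M u) :
    ∃ C > 0, ∀ L h : ℝ, 1 ≤ L → 0 < h → h ≤ 1 →
      ∫ u in (0:ℝ)..(L - h), (e (u+h) ^ 2 * Real.exp (-σ * (u+h)) - e u ^ 2 * Real.exp (-σ * u)) ^ 2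
        ≤ C * h * Real.exp ((3 - 2 * σ + 4 * δ) * L) := by
  set θ := 3 - 2 * σ + 4 * δ with hθd
  have hθ : 0 < θ := by linarith
  set a := 2 * σ - 2 - 3 * δ with had
  set B := 2 * A^2 * Real.exp 4 * (2 * A * Real.exp 2 + 2 * A^2) with hB
  have hB0 : 0 < B := by positivity
  refine ⟨B * ((3 * A / θ + A) + 1 / θ), by positivity, fun L h hL h0 h1 => ?_⟩
  have hpt : ∀ u, 0 ≤ u → (e (u+h) ^ 2 * Real.exp (-σ * (u+h)) - e u ^ 2 * Real.exp (-σ * u)) ^ 2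
      ≤ B * (Real.exp (-a * u) * (M (u + h) - M u) + h * Real.exp (θ * u)) := by
    intro u hu
    have hv : 0 ≤ u + h := by linarith
    set x := Real.exp ((2/3+δ) * u) with hx
    set s := Real.exp (-σ * u) with hs
    have x0 : 0 < x := Real.exp_pos _
    have s0 : 0 < s := Real.exp_pos _
    have b1 : |e u| ≤ A * x := heb u hu
    have b2 : |e (u+h)| ≤ A * Real.exp 2 * x := by
      refine (heb _ hv).trans ?_
      rw [mul_assoc, hx, ← Real.exp_add]
      gcongr
      nlinarith
    have b3 : Real.exp (-σ * (u+h)) ≤ s := by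
      rw [hs]; exact Real.exp_le_exp.2 (by nlinarith)
    have b4 : s - Real.exp (-σ * (u+h)) ≤ 2 * h * s := by
      have : Real.exp (-σ * (u+h)) = s * Real.exp (-σ * h) := by rw [hs, ← Real.exp_add]; ring_nf
      rw [this]
      have := Real.add_one_le_exp (-σ * h)
      nlinarith [mul_le_mul_of_nonneg_left this s0.le, mul_pos s0 h0]
    set s' := Real.exp (-σ * (u+h)) with hs'
    have s'0 : 0 < s' := Real.exp_pos _
    have bd := hd u (u+h) hu (by linarith)
    set Δ := M (u+h) - M u
    have hΔ : 0 ≤ Δ := (abs_nonneg _).trans bd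
    have E2 : 1 ≤ Real.exp 2 := Real.one_le_exp (by norm_num)
    have E4 : Real.exp 4 = Real.exp 2 * Real.exp 2 := by rw [← Real.exp_add]; norm_num
    set p := e (u+h)
    set q := e u
    have q2 : q^2 ≤ A^2 * x^2 := by
      rw [← sq_abs q, ← mul_pow]; exact pow_le_pow_left₀ (abs_nonneg _) b1 2
    have p2 : p^2 ≤ A^2 * Real.exp 4 * x^2 := by
      rw [← sq_abs p]
      refine (pow_le_pow_left₀ (abs_nonneg _) b2 2).trans (le_of_eq ?_)
      rw [E4]; ring
    have c1 : |p^2 * s' - q^2 * s| ≤ 2 * A^2 * Real.exp 4 * (x^2 * s) := by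
      have t1 : p^2 * s' ≤ A^2 * Real.exp 4 * x^2 * s := mul_le_mul p2 b3 s'0.le (by positivity)
      have t2 : q^2 * s ≤ A^2 * Real.exp 4 * x^2 * s := by
        apply mul_le_mul_of_nonneg_right _ s0.le
        refine q2.trans ?_
        have : A^2 * 1 * x^2 ≤ A^2 * Real.exp 4 * x^2 := by
          gcongr; exact Real.one_le_exp (by norm_num)
        linarith
      have t3 : 0 ≤ p^2 * s' := by positivity
      have t4 : 0 ≤ q^2 * s := by positivity
      rw [abs_le]; constructor <;> linarith
    have c2 : |p^2 * s' - q^2 * s| ≤ 2 * A * Real.exp 2 * (x * s * Δ) + 2 * A^2 * (h * (x^2 * s)) := by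
      have : p^2 * s' - q^2 * s = (p - q) * (p + q) * s' + - (q^2 * (s - s')) := by ring
      rw [this]
      refine (abs_add_le _ _).trans ?_
      apply add_le_add
      · rw [abs_mul, abs_mul, abs_of_pos s'0]
        have t1 : |p + q| ≤ 2 * A * Real.exp 2 * x := by
          refine (abs_add_le _ _).trans ?_
          have : A * 1 * x ≤ A * Real.exp 2 * x := by gcongr
          linarith
        calc |p - q| * |p + q| * s' ≤ Δ * (2 * A * Real.exp 2 * x) * s := by gcongr
          _ = _ := by ring
      · rw [abs_neg, abs_of_nonneg (mul_nonneg (sq_nonneg _) (by linarith))]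
        calc q^2 * (s - s') ≤ (A^2 * x^2) * (2 * h * s) := by
              apply mul_le_mul q2 b4 (by linarith) (by positivity)
          _ = _ := by ring
    have x3 : x^2 * s * (x * s) = Real.exp (-a * u) := by
      rw [hx, hs, ← Real.exp_nat_mul, ← Real.exp_add, ← Real.exp_add, ← Real.exp_add, had]
      congr 1; push_cast; ring
    have x4 : x^2 * s * (x^2 * s) ≤ Real.exp (θ * u) := by
      rw [hx, hs, ← Real.exp_nat_mul, ← Real.exp_add, ← Real.exp_add, hθd]
      apply Real.exp_le_exp.2
      push_cast
      nlinarith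
    calc (p^2 * s' - q^2 * s)^2 = |p^2 * s' - q^2 * s| * |p^2 * s' - q^2 * s| := by
          rw [← sq_abs]; ring
      _ ≤ (2 * A^2 * Real.exp 4 * (x^2 * s)) * (2 * A * Real.exp 2 * (x * s * Δ) + 2 * A^2 * (h * (x^2 * s))) := by
          apply mul_le_mul c1 c2 (abs_nonneg _) (by positivity)
      _ = 2 * A^2 * Real.exp 4 * (2 * A * Real.exp 2 * (Real.exp (-a*u) * Δ) + 2 * A^2 * (h * (x^2 * s * (x^2 * s)))) := by
          rw [← x3]; ring
      _ ≤ 2 * A^2 * Real.exp 4 * (2 * A * Real.exp 2 * (Real.exp (-a*u) * Δ) + 2 * A^2 * (h * Real.exp (θ * u))) := by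
          gcongr
      _ ≤ B * (Real.exp (-a * u) * Δ + h * Real.exp (θ * u)) := by
          rw [hB, mul_assoc (2 * A^2 * Real.exp 4)]
          apply mul_le_mul_of_nonneg_left _ (by positivity)
          have r1 : 0 ≤ 2 * A^2 * (Real.exp (-a*u) * Δ) := by positivity
          have r2 : 0 ≤ 2 * A * Real.exp 2 * (h * Real.exp (θ * u)) := by positivity
          nlinarith
  have i1 : IntervalIntegrable (fun u => Real.exp (-a * u) * (M (u + h) - M u)) volume 0 (L-h) :=
    Continuous.intervalIntegrable (by fun_prop) _ _
  have i2 : IntervalIntegrable (fun u => h * Real.exp (θ * u)) volume 0 (L-h) :=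
    Continuous.intervalIntegrable (by fun_prop) _ _
  have s1 : ∫ u in (0:ℝ)..(L - h), (e (u+h) ^ 2 * Real.exp (-σ * (u+h)) - e u ^ 2 * Real.exp (-σ * u)) ^ 2
      ≤ ∫ u in (0:ℝ)..(L - h), B * (Real.exp (-a * u) * (M (u + h) - M u) + h * Real.exp (θ * u)) := by
    apply intervalIntegral.integral_mono_on (by linarith)
    · exact Continuous.intervalIntegrable (by fun_prop) _ _
    · exact (i1.add i2).const_mul _
    · intro u hu; exact hpt u hu.1
  rw [intervalIntegral.integral_const_mul, intervalIntegral.integral_add i1 i2, intervalIntegral.integral_const_mul] at s1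
  have s2 := M_int M hMc A a δ θ hA (by linarith) (by linarith) hθ (by rw [hθd, had]; ring) hM0 hM1 L h hL h0 h1
  have s3 : ∫ u in (0:ℝ)..(L - h), Real.exp (θ * u) ≤ Real.exp (θ * L) / θ := by
    refine (exp_int_le hθ 0 (L-h)).trans ?_
    gcongr; linarith
  refine s1.trans ?_
  calc _ ≤ B * ((3 * A / θ + A) * h * Real.exp (θ * L) + h * (Real.exp (θ * L) / θ)) :=
        mul_le_mul_of_nonneg_left (add_le_add s2 (mul_le_mul_of_nonneg_left s3 h0.le)) hB0.le
    _ = _ := by ring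

lemma head_bound (g : ℝ → ℝ) (hg : Continuous g) (θ B : ℝ) (hθ : 0 < θ) (hB : 0 < B)
    (hedge : ∀ u, 0 ≤ u → g u ^ 2 ≤ B * Real.exp (θ * u))
    (L h : ℝ) (hL : 1 ≤ L) (h0 : 0 < h) (h1 : h ≤ 1)
    (hdiff : ∫ u in (0:ℝ)..(L - h), (g (u+h) - g u) ^ 2 ≤ B * h * Real.exp (θ * L)) :
    ∫ t in (1/h)..(2*(1/h)), ‖∫ u in (0:ℝ)..L, (g u : ℂ) * cexp (-(I * t * u))‖ ^ 2
      ≤ (2 * (Real.exp 4 * (2 * Real.pi)) * (3 * B)) * h * Real.exp (θ * L) := by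
  set gL : ℝ → ℝ := (Set.Ioc 0 L).indicator g with hgL
  have hgm : Measurable gL := hg.measurable.indicator measurableSet_Ioc
  have hgi : Integrable gL := by
    rw [hgL, integrable_indicator_iff measurableSet_Ioc]
    exact (hg.integrableOn_Icc).mono_set Set.Ioc_subset_Icc_self
  have hg2i : Integrable (fun u => gL u ^ 2) := by
    have : (fun u => gL u ^ 2) = (Set.Ioc 0 L).indicator (fun u => g u ^ 2) := by
      funext u; simp only [hgL, Set.indicator]; split_ifs <;> simp
    rw [this, integrable_indicator_iff measurableSet_Ioc]
    exact ((hg.pow 2).integrableOn_Icc).mono_set Set.Ioc_subset_Icc_self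
  set D : ℝ → ℝ := fun u => gL (u + h) - gL u with hD
  have hDm : Measurable D := (hgm.comp (measurable_id.add_const h)).sub hgm
  have hDi : Integrable D := (hgi.comp_add_right h).sub hgi
  have hD2i : Integrable (fun u => D u ^ 2) := by
    have i1 := ((hg2i.comp_add_right h).add hg2i).const_mul 2
    refine i1.mono' (hDm.pow_const 2).aestronglyMeasurable ?_
    refine Filter.Eventually.of_forall fun u => ?_
    rw [Real.norm_of_nonneg (sq_nonneg _)]
    simp only [hD, Pi.add_apply]
    nlinarith [sq_nonneg (gL (u+h) + gL u)]
  -- integral of D^2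
  have hDint : ∫ u, D u ^ 2 ≤ 3 * B * h * Real.exp (θ * L) := by
    have hsupp : Function.support (fun u => D u ^ 2) ⊆ Set.Ioc (-h) L := by
      intro u hu
      by_contra hc
      apply hu
      have n1 : u + h ∉ Set.Ioc 0 L := by
        intro hh; exact hc ⟨by linarith [hh.1], by linarith [hh.2]⟩
      have n2 : u ∉ Set.Ioc 0 L := by
        intro hh; exact hc ⟨by linarith [hh.1], by linarith [hh.2]⟩
      simp [hD, hgL, n1, n2]
    rw [← intervalIntegral.integral_eq_integral_of_support_subset hsupp]
    have ii : ∀ x y, IntervalIntegrable (fun u => D u ^ 2) volume x y := fun x y => hD2i.intervalIntegrable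
    rw [← intervalIntegral.integral_add_adjacent_intervals (ii (-h) 0) (ii 0 L),
      ← intervalIntegral.integral_add_adjacent_intervals (ii 0 (L-h)) (ii (L-h) L)]
    have hexp : ∀ u, 0 ≤ u → u ≤ L → g u ^ 2 ≤ B * Real.exp (θ * L) := by
      intro u hu huL
      refine (hedge u hu).trans ?_
      gcongr
    have q1 : ∫ u in (-h)..0, D u ^ 2 ≤ B * h * Real.exp (θ * L) := by
      have : ∫ u in (-h)..0, D u ^ 2 ≤ ∫ u in (-h)..0, B * Real.exp (θ * L) := by
        apply intervalIntegral.integral_mono_on_of_le_Ioo (by linarith) (ii _ _) (by simp)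
        intro u hu
        have n2 : u ∉ Set.Ioc 0 L := fun hh => by linarith [hh.1, hu.2]
        have n1 : u + h ∈ Set.Ioc 0 L := ⟨by linarith [hu.1], by linarith [hu.2]⟩
        simp only [hD, hgL, Set.indicator_of_mem n1, Set.indicator_of_notMem n2, sub_zero]
        exact hexp _ n1.1.le n1.2
      refine this.trans (le_of_eq ?_)
      rw [intervalIntegral.integral_const, smul_eq_mul]; ring
    have q3 : ∫ u in (L-h)..L, D u ^ 2 ≤ B * h * Real.exp (θ * L) := by
      have : ∫ u in (L-h)..L, D u ^ 2 ≤ ∫ u in (L-h)..L, B * Real.exp (θ * L) := by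
        apply intervalIntegral.integral_mono_on_of_le_Ioo (by linarith) (ii _ _) (by simp)
        intro u hu
        have n2 : u ∈ Set.Ioc 0 L := ⟨by linarith [hu.1], hu.2.le⟩
        have n1 : u + h ∉ Set.Ioc 0 L := fun hh => by linarith [hh.2, hu.1]
        simp only [hD, hgL, Set.indicator_of_mem n2, Set.indicator_of_notMem n1, zero_sub, neg_sq]
        exact hexp _ n2.1.le n2.2
      refine this.trans (le_of_eq ?_)
      rw [intervalIntegral.integral_const, smul_eq_mul]; ring
    have q2 : ∫ u in (0:ℝ)..(L-h), D u ^ 2 ≤ B * h * Real.exp (θ * L) := by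
      refine le_trans ?_ hdiff
      apply intervalIntegral.integral_mono_on_of_le_Ioo (by linarith) (ii _ _)
      · exact Continuous.intervalIntegrable (by fun_prop) _ _
      · intro u hu
        have n2 : u ∈ Set.Ioc 0 L := ⟨hu.1, by linarith [hu.2]⟩
        have n1 : u + h ∈ Set.Ioc 0 L := ⟨by linarith [hu.1], by linarith [hu.2]⟩
        simp only [hD, hgL, Set.indicator_of_mem n2, Set.indicator_of_mem n1]
        exact le_rfl
    linarith
  set G : ℝ → ℂ := fun t => ∫ u, (gL u : ℂ) * cexp (-(I * t * u)) with hG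
  have hGc : Continuous G := ft_cont hgi
  have hGe : ∀ t : ℝ, ∫ u in (0:ℝ)..L, (g u : ℂ) * cexp (-(I * t * u)) = G t := by
    intro t
    rw [intervalIntegral.integral_of_le (by linarith), ← integral_indicator measurableSet_Ioc, hG]
    congr 1; funext u
    simp only [hgL, Set.indicator]; split_ifs <;> simp
  have hDG : ∀ t : ℝ, ∫ u, (D u : ℂ) * cexp (-(I * t * u)) = (cexp (I * t * h) - 1) * G t := by
    intro t
    have hI : ∀ f : ℝ → ℝ, Integrable f → Integrable (fun u : ℝ => (f u : ℂ) * cexp (-(I * t * u))) := by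
      intro f hf
      refine hf.ofReal.mul_bdd (c := 1) (by fun_prop) ?_
      refine Filter.Eventually.of_forall fun u => ?_
      have : -(I * t * u) = ((-(t*u) : ℝ) : ℂ) * I := by push_cast; ring
      rw [this, Complex.norm_exp_ofReal_mul_I]
    have s1 : ∫ u, (gL (u + h) : ℂ) * cexp (-(I * t * u)) = cexp (I * t * h) * G t := by
      have : ∀ u : ℝ, (gL (u + h) : ℂ) * cexp (-(I * t * u)) =
          cexp (I * t * h) * ((gL (u+h) : ℂ) * cexp (-(I * t * (u + h : ℝ)))) := by
        intro u
        have : -(I * t * u) = I * t * h + -(I * t * (u + h : ℝ)) := by push_cast; ring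
        rw [this, Complex.exp_add]; ring
      rw [integral_congr_ae (Filter.Eventually.of_forall this), integral_const_mul]
      congr 1
      exact integral_add_right_eq_self (fun u : ℝ => (gL u : ℂ) * cexp (-(I * t * u))) h
    have : ∀ u : ℝ, (D u : ℂ) * cexp (-(I * t * u)) =
        (gL (u + h) : ℂ) * cexp (-(I * t * u)) - (gL u : ℂ) * cexp (-(I * t * u)) := by
      intro u; simp only [hD]; push_cast; ring
    rw [integral_congr_ae (Filter.Eventually.of_forall this),
      integral_sub (hI _ (hgi.comp_add_right h)) (hI _ hgi), s1]
    ring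
  have hb := bessel D hDi hD2i (1/h) (by positivity)
  have hlow : ∀ t, 1/h ≤ t → t ≤ 2 * (1/h) →
      ‖G t‖^2 ≤ 2 * ‖∫ u, (D u : ℂ) * cexp (-(I * t * u))‖ ^ 2 := by
    intro t ht1 ht2
    rw [hDG, norm_mul, mul_pow]
    have hh1 : 1 ≤ t * h := by rwa [div_le_iff₀ h0] at ht1
    have hh2 : t * h ≤ 2 := by
      have := mul_le_mul_of_nonneg_right ht2 h0.le
      rwa [mul_assoc, one_div, inv_mul_cancel₀ h0.ne', mul_one] at this
    have : ‖cexp (I * t * h) - 1‖^2 = 2 - 2 * Real.cos (t * h) := by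
      have e : I * t * h = ((t * h : ℝ) : ℂ) * I := by push_cast; ring
      rw [e, Complex.exp_mul_I, ← Complex.ofReal_cos, ← Complex.ofReal_sin, ← Complex.normSq_eq_norm_sq, Complex.normSq_apply]
      simp only [Complex.sub_re, Complex.sub_im, Complex.add_re, Complex.add_im, Complex.mul_re, Complex.mul_im,
        Complex.ofReal_re, Complex.ofReal_im, Complex.I_re, Complex.I_im, Complex.one_re, Complex.one_im]
      nlinarith [Real.sin_sq_add_cos_sq (t*h)]
    rw [this]
    have hc : Real.cos (t*h) ≤ 5/9 := by
      refine le_trans ?_ Real.cos_one_le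
      apply Real.cos_le_cos_of_nonneg_of_le_pi (by norm_num) _ hh1
      linarith [Real.pi_gt_three]
    nlinarith [sq_nonneg ‖G t‖]
  simp only [hGe]
  have hDc := ft_cont hDi
  have f1 : ∫ t in (1/h)..(2*(1/h)), ‖G t‖^2 ≤
      ∫ t in (1/h)..(2*(1/h)), 2 * ‖∫ u, (D u : ℂ) * cexp (-(I * t * u))‖ ^ 2 := by
    have : 0 < 1/h := by positivity
    apply intervalIntegral.integral_mono_on (by linarith)
    · exact Continuous.intervalIntegrable (by fun_prop) _ _
    · exact Continuous.intervalIntegrable (by fun_prop) _ _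
    · intro t ht; exact hlow t ht.1 ht.2
  rw [intervalIntegral.integral_const_mul] at f1
  have hp : 0 < Real.exp 4 * (2 * Real.pi) := by positivity
  have := mul_le_mul_of_nonneg_left hDint hp.le
  calc _ ≤ _ := f1
    _ ≤ 2 * (Real.exp 4 * (2 * Real.pi) * (3 * B * h * Real.exp (θ * L))) := by linarith
    _ = _ := by ring

lemma tail_bound (e : ℝ → ℝ) (he : Continuous e) (A σ δ κ : ℝ) (hA : 1 ≤ A)
    (hσ1 : 1 < σ) (hκ : 0 < κ) (hκe : κ = σ - 1 - δ)
    (hms : ∀ u, 0 ≤ u → ∫ w in (0:ℝ)..u, e w ^ 2 * Real.exp w ≤ A * Real.exp ((2 + δ) * u)) :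
    IntegrableOn (fun u => e u ^ 2 * Real.exp (-σ * u)) (Set.Ioi 0) ∧
    ∀ L, 0 ≤ L → ∫ u in Set.Ioi L, e u ^ 2 * Real.exp (-σ * u)
      ≤ (A + (1+σ) * A / κ) * Real.exp (-κ * L) := by
  set g : ℝ → ℝ := fun u => e u ^ 2 * Real.exp (-σ * u) with hg
  have hgc : Continuous g := by fun_prop
  have hg0 : ∀ u, 0 ≤ g u := fun u => by positivity
  set Ψ : ℝ → ℝ := fun u => ∫ w in (0:ℝ)..u, e w ^ 2 * Real.exp w with hΨ
  have hΨd : ∀ u, HasDerivAt Ψ (e u ^ 2 * Real.exp u) u := fun u =>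
    (Continuous.integral_hasStrictDerivAt (by fun_prop) 0 u).hasDerivAt
  have hΨc : Continuous Ψ := continuous_iff_continuousAt.2 fun u => (hΨd u).continuousAt
  have hΨ0 : ∀ u, 0 ≤ u → 0 ≤ Ψ u := fun u hu =>
    intervalIntegral.integral_nonneg hu (fun w _ => by positivity)
  have key : ∀ L Y, 0 ≤ L → L ≤ Y → ∫ u in L..Y, g u ≤ (A + (1+σ) * A / κ) * Real.exp (-κ * L) := by
    intro L Y hL hY
    have vd : ∀ u, HasDerivAt (fun u => Real.exp (-(1+σ) * u)) (-(1+σ) * Real.exp (-(1+σ) * u)) u := by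
      intro u
      have := ((hasDerivAt_id u).const_mul (-(1+σ))).exp
      simp only [id, mul_one] at this
      rw [mul_comm]; exact this
    have ibp := intervalIntegral.integral_mul_deriv_eq_deriv_mul (a := L) (b := Y)
      (fun u _ => hΨd u) (fun u _ => vd u)
      (Continuous.intervalIntegrable (by fun_prop) _ _) (Continuous.intervalIntegrable (by fun_prop) _ _)
    have e1 : ∫ u in L..Y, (e u ^ 2 * Real.exp u) * Real.exp (-(1+σ) * u) = ∫ u in L..Y, g u := by
      congr 1; funext u
      rw [mul_assoc, ← Real.exp_add]; simp only [hg]; congr 2; ring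
    have e2 : ∫ u in L..Y, Ψ u * (-(1+σ) * Real.exp (-(1+σ) * u)) = -(1+σ) * ∫ u in L..Y, Ψ u * Real.exp (-(1+σ) * u) := by
      rw [← intervalIntegral.integral_const_mul]; congr 1; funext u; ring
    rw [e1, e2] at ibp
    have hb : ∀ u, 0 ≤ u → Ψ u * Real.exp (-(1+σ) * u) ≤ A * Real.exp (-κ * u) := by
      intro u hu
      have : Real.exp (-κ * u) = Real.exp ((2+δ) * u) * Real.exp (-(1+σ)*u) := by
        rw [← Real.exp_add, hκe]; congr 1; ring
      rw [this, ← mul_assoc]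
      exact mul_le_mul_of_nonneg_right (hms u hu) (Real.exp_pos _).le
    have b1 : ∫ u in L..Y, Ψ u * Real.exp (-(1+σ) * u) ≤ A * (Real.exp (-κ * L) / κ) := by
      have : ∫ u in L..Y, Ψ u * Real.exp (-(1+σ) * u) ≤ ∫ u in L..Y, A * Real.exp (-κ * u) := by
        apply intervalIntegral.integral_mono_on hY (Continuous.intervalIntegrable (by fun_prop) _ _) (Continuous.intervalIntegrable (by fun_prop) _ _)
        intro u hu; exact hb u (by linarith [hu.1])
      refine this.trans ?_
      rw [intervalIntegral.integral_const_mul]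
      apply mul_le_mul_of_nonneg_left _ (by linarith)
      have : ∫ u in L..Y, Real.exp (-κ * u) = (Real.exp (-κ * L) - Real.exp (-κ * Y)) / κ := by
        rw [intervalIntegral.integral_comp_mul_left (fun x => Real.exp x) (by linarith), integral_exp, smul_eq_mul]
        field_simp
        ring
      rw [this]
      gcongr
      linarith [Real.exp_pos (-κ * Y)]
    have b2 := hb Y (by linarith)
    have b3 : A * Real.exp (-κ * Y) ≤ A * Real.exp (-κ * L) :=
      mul_le_mul_of_nonneg_left (Real.exp_le_exp.2 (by nlinarith)) (by linarith)
    have b4 : 0 ≤ Ψ L * Real.exp (-(1+σ) * L) := mul_nonneg (hΨ0 L hL) (Real.exp_pos _).le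
    have b5 := mul_le_mul_of_nonneg_left b1 (show 0 ≤ 1 + σ by linarith)
    calc ∫ u in L..Y, g u ≤ A * Real.exp (-κ * L) + (1+σ) * (A * (Real.exp (-κ * L) / κ)) := by linarith
      _ = _ := by ring
  have hint : IntegrableOn g (Set.Ioi 0) := by
    refine integrableOn_Ioi_of_intervalIntegral_norm_bounded (l := Filter.atTop) (b := id) ((A + (1+σ) * A / κ) * Real.exp (-κ * 0)) 0
      (fun i => (hgc.integrableOn_Icc).mono_set Set.Ioc_subset_Icc_self) Filter.tendsto_id ?_
    filter_upwards [Filter.eventually_ge_atTop 0] with Y hY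
    have : ∀ u, ‖g u‖ = g u := fun u => Real.norm_of_nonneg (hg0 u)
    simp only [this]
    exact key 0 Y le_rfl hY
  refine ⟨hint, fun L hL => ?_⟩
  have ht := intervalIntegral_tendsto_integral_Ioi L (hint.mono_set (Set.Ioi_subset_Ioi hL)) Filter.tendsto_id
  refine le_of_tendsto ht ?_
  filter_upwards [Filter.eventually_ge_atTop L] with Y hY
  exact key L Y hL hY

lemma abstract_main (e M : ℝ → ℝ) (he : Continuous e) (hMc : Continuous M) (A σ δ : ℝ) (hA : 1 ≤ A)
    (hσ1 : 1 < σ) (hσ2 : σ ≤ 3/2) (hδ : 0 < δ) (hδ2 : δ ≤ (σ - 1)/2)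
    (heb : ∀ u, 0 ≤ u → |e u| ≤ A * Real.exp ((2/3 + δ) * u))
    (hM0 : ∀ u, 0 ≤ u → 0 ≤ M u) (hM1 : ∀ u, 0 ≤ u → M u ≤ A * Real.exp ((1 + δ) * u))
    (hd : ∀ u v, 0 ≤ u → u ≤ v → |e v - e u| ≤ M v - M u)
    (hms : ∀ u, 0 ≤ u → ∫ w in (0:ℝ)..u, e w ^ 2 * Real.exp w ≤ A * Real.exp ((2 + δ) * u)) :
    Continuous (fun t : ℝ => ∫ u in Set.Ioi (0:ℝ), ((e u ^ 2 * Real.exp (-σ * u) : ℝ) : ℂ) * cexp (-(I * t * u))) ∧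
    ∃ C > 0, ∀ U : ℝ, 1 ≤ U → ∫ t in U..(2*U),
      ‖∫ u in Set.Ioi (0:ℝ), ((e u ^ 2 * Real.exp (-σ * u) : ℝ) : ℂ) * cexp (-(I * t * u))‖ ^ 2
        ≤ C * U ^ (5 - 4 * σ + 8 * δ) := by
  set κ := σ - 1 - δ with hκe
  have hκ : 0 < κ := by linarith
  obtain ⟨gi, gt⟩ := tail_bound e he A σ δ κ hA hσ1 hκ hκe hms
  obtain ⟨B, hB, hdiff⟩ := diff_bound e M he hMc A σ δ hA hσ1 hσ2 hδ hδ2 heb hM0 hM1 hd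
  set g : ℝ → ℝ := fun u => e u ^ 2 * Real.exp (-σ * u) with hg
  have hgc : Continuous g := by fun_prop
  have hg0 : ∀ u, 0 ≤ g u := fun u => by positivity
  set G : ℝ → ℂ := fun t : ℝ => ∫ u in Set.Ioi (0:ℝ), (g u : ℂ) * cexp (-(I * t * u)) with hG
  have hGc : Continuous G := ft_cont gi
  refine ⟨hGc, ?_⟩
  set θ := 3 - 2 * σ + 4 * δ with hθd
  have hθ : 0 < θ := by linarith
  set B' := B + A^4 with hB'
  have hB'0 : 0 < B' := by positivity
  have hedge : ∀ u, 0 ≤ u → g u ^ 2 ≤ B' * Real.exp (θ * u) := by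
    intro u hu
    have h1 : e u ^ 2 ≤ A^2 * Real.exp ((2/3+δ)*u) ^ 2 := by
      rw [← sq_abs, ← mul_pow]; exact pow_le_pow_left₀ (abs_nonneg _) (heb u hu) 2
    have h2 : g u ≤ A^2 * Real.exp ((2/3+δ)*u) ^ 2 * Real.exp (-σ * u) :=
      mul_le_mul_of_nonneg_right h1 (Real.exp_pos _).le
    have h3 := pow_le_pow_left₀ (hg0 u) h2 2
    refine h3.trans ?_
    have h4 : (A^2 * Real.exp ((2/3+δ)*u) ^ 2 * Real.exp (-σ * u))^2
        = A^4 * Real.exp ((8/3 + 4 * δ - 2 * σ) * u) := by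
      have : Real.exp ((8/3 + 4 * δ - 2 * σ) * u) = (Real.exp ((2/3+δ)*u) ^ 2 * Real.exp (-σ * u))^2 := by
        rw [← Real.exp_nat_mul, ← Real.exp_add, ← Real.exp_nat_mul]; congr 1; push_cast; ring
      rw [this]; ring
    rw [h4]
    apply mul_le_mul _ (Real.exp_le_exp.2 _) (Real.exp_pos _).le hB'0.le
    · linarith
    · rw [hθd]; nlinarith
  set C1 := 2 * (Real.exp 4 * (2 * Real.pi)) * (3 * B') with hC1
  have hC10 : 0 < C1 := by positivity
  set C2 := A + (1+σ) * A / κ with hC2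
  have hC20 : 0 < C2 := by positivity
  refine ⟨2 * C1 * Real.exp θ + 2 * C2 ^ 2, by positivity, fun U hU => ?_⟩
  have hU0 : 0 < U := by linarith
  have hlog : 0 ≤ Real.log U := Real.log_nonneg hU
  set L := 2 * Real.log U + 1 with hL
  have hexpL : ∀ c : ℝ, Real.exp (c * L) = U ^ (2 * c) * Real.exp c := by
    intro c
    rw [Real.rpow_def_of_pos hU0, ← Real.exp_add, hL]; congr 1; ring
  have hh := head_bound g hgc θ B' hθ hB'0 hedge L (1/U) (by linarith) (by positivity)
    (by rw [div_le_one hU0]; exact hU) (by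
      refine (hdiff L (1/U) (by linarith) (by positivity) (by rw [div_le_one hU0]; exact hU)).trans ?_
      gcongr
      rw [hB']
      linarith [pow_pos (lt_of_lt_of_le one_pos hA) 4])
  rw [one_div_one_div] at hh
  set H : ℝ → ℂ := fun t : ℝ => ∫ u in (0:ℝ)..L, (g u : ℂ) * cexp (-(I * t * u)) with hH
  have hL0 : 0 ≤ L := by linarith
  have hHc : Continuous H := by
    have := ft_cont (gi.mono_set (t := Set.Ioi 0) (s := Set.Ioc 0 L) (fun x hx => hx.1))
    simp only [hH, intervalIntegral.integral_of_le hL0]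
    exact this
  have hgint : ∀ t : ℝ, IntegrableOn (fun u : ℝ => (g u : ℂ) * cexp (-(I * t * u))) (Set.Ioi 0) := by
    intro t
    refine gi.ofReal.mul_bdd (c := 1) (by fun_prop) ?_
    refine Filter.Eventually.of_forall fun u => ?_
    have : -(I * t * u) = ((-(t*u) : ℝ) : ℂ) * I := by push_cast; ring
    rw [this, Complex.norm_exp_ofReal_mul_I]
  have hR : ∀ t, ‖G t - H t‖ ≤ C2 * Real.exp (-κ * L) := by
    intro t
    have : G t - H t = ∫ u in Set.Ioi L, (g u : ℂ) * cexp (-(I * t * u)) := by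
      rw [sub_eq_iff_eq_add', hG, hH]
      simp only
      rw [intervalIntegral.integral_of_le hL0, ← setIntegral_union (Set.Ioc_disjoint_Ioi le_rfl) measurableSet_Ioi,
        Set.Ioc_union_Ioi_eq_Ioi hL0]
      · exact (hgint t).mono_set (fun x hx => hx.1)
      · exact (hgint t).mono_set (Set.Ioi_subset_Ioi hL0)
    rw [this]
    refine (norm_integral_le_integral_norm _).trans (le_trans (le_of_eq ?_) (gt L hL0))
    congr 1; funext u
    have : -(I * t * u) = ((-(t*u) : ℝ) : ℂ) * I := by push_cast; ring
    rw [norm_mul, this, Complex.norm_exp_ofReal_mul_I, mul_one, Complex.norm_real, Real.norm_of_nonneg (hg0 u)]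
  have hpt : ∀ t, ‖G t‖^2 ≤ 2 * ‖H t‖^2 + 2 * (C2 * Real.exp (-κ * L))^2 := by
    intro t
    have h1 : ‖G t‖ ≤ ‖H t‖ + C2 * Real.exp (-κ * L) := by
      have := norm_add_le (H t) (G t - H t)
      rw [add_sub_cancel] at this
      linarith [hR t]
    have := pow_le_pow_left₀ (norm_nonneg _) h1 2
    nlinarith [sq_nonneg (‖H t‖ - C2 * Real.exp (-κ * L))]
  have s1 : ∫ t in U..(2*U), ‖G t‖^2 ≤ ∫ t in U..(2*U), (2 * ‖H t‖^2 + 2 * (C2 * Real.exp (-κ * L))^2) := by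
    apply intervalIntegral.integral_mono_on (by linarith) (Continuous.intervalIntegrable (by fun_prop) _ _) (Continuous.intervalIntegrable (by fun_prop) _ _)
    intro t _; exact hpt t
  rw [intervalIntegral.integral_add (Continuous.intervalIntegrable (by fun_prop) _ _) (by simp), intervalIntegral.integral_const_mul,
    intervalIntegral.integral_const, smul_eq_mul] at s1
  have r1 : C1 * (1/U) * Real.exp (θ * L) = C1 * Real.exp θ * U ^ (5 - 4 * σ + 8 * δ) := by
    have : U ^ (5 - 4 * σ + 8 * δ) = U ^ (2 * θ) * (1/U) := by
      rw [one_div, ← Real.rpow_neg_one U, ← Real.rpow_add hU0, hθd]; congr 1; ring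
    rw [hexpL, this]; ring
  have r2 : U * Real.exp (-κ * L)^2 ≤ U ^ (5 - 4 * σ + 8 * δ) := by
    rw [← Real.exp_nat_mul, ← mul_assoc, hexpL]
    have h1 : Real.exp (((2:ℕ):ℝ) * -κ) ≤ 1 := by
      apply Real.exp_le_one_iff.2; push_cast; linarith
    calc U * (U ^ (2 * (((2:ℕ):ℝ) * -κ)) * Real.exp (((2:ℕ):ℝ) * -κ))
        ≤ U * (U ^ (2 * (((2:ℕ):ℝ) * -κ)) * 1) := by gcongr
      _ = U ^ (1 + 2 * (((2:ℕ):ℝ) * -κ)) := by rw [Real.rpow_add hU0, Real.rpow_one, mul_one]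
      _ ≤ _ := by
        apply Real.rpow_le_rpow_of_exponent_le hU
        push_cast; rw [hκe]; linarith
  rw [r1] at hh
  calc _ ≤ _ := s1
    _ = 2 * (∫ t in U..(2*U), ‖H t‖^2) + 2 * C2^2 * (U * Real.exp (-κ * L)^2) := by ring
    _ ≤ 2 * (C1 * Real.exp θ * U ^ (5 - 4 * σ + 8 * δ)) + 2 * C2^2 * U ^ (5 - 4 * σ + 8 * δ) := by
        apply add_le_add
        · exact mul_le_mul_of_nonneg_left hh (by norm_num)
        · exact mul_le_mul_of_nonneg_left r2 (by positivity)
    _ = _ := by ring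

lemma dyadic (f : ℝ → ℝ) (hf : Continuous f) (hf0 : ∀ t, 0 ≤ f t) (C a : ℝ) (hC : 0 < C) (ha : 1 ≤ a)
    (h : ∀ U, 1 ≤ U → ∫ t in U..(2*U), f t ≤ C * U ^ a) :
    ∀ T, 1 ≤ T → ∫ t in (1:ℝ)..T, f t ≤ C * T ^ a := by
  have ii : ∀ x y, IntervalIntegrable f volume x y := fun x y => hf.intervalIntegrable _ _
  have key : ∀ n : ℕ, ∀ T, 1 ≤ T → T ≤ 2 ^ n → ∫ t in (1:ℝ)..T, f t ≤ C * T ^ a := by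
    intro n
    induction n with
    | zero =>
      intro T h1 h2
      have : T = 1 := le_antisymm (by simpa using h2) h1
      subst this
      simp [hC.le]
    | succ n ih =>
      intro T h1 h2
      by_cases hT : T ≤ 2
      · have m1 : ∫ t in (1:ℝ)..T, f t ≤ ∫ t in (1:ℝ)..(2*1), f t := by
          rw [← intervalIntegral.integral_add_adjacent_intervals (ii 1 T) (ii T (2*1))]
          have : 0 ≤ ∫ t in T..(2*1), f t := intervalIntegral.integral_nonneg (by linarith) (fun t _ => hf0 t)
          linarith
        refine m1.trans ((h 1 le_rfl).trans ?_)
        gcongr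
      · push Not at hT
        have hh := h (T/2) (by linarith)
        have i := ih (T/2) (by linarith) (by rw [pow_succ] at h2; linarith)
        rw [show 2 * (T/2) = T by ring] at hh
        rw [← intervalIntegral.integral_add_adjacent_intervals (ii 1 (T/2)) (ii (T/2) T)]
        have : (T/2)^a * 2 ≤ T^a := by
          rw [Real.div_rpow (by linarith) (by norm_num)]
          have h2a : (2:ℝ) ≤ 2 ^ a := by
            conv_lhs => rw [← Real.rpow_one 2]
            exact Real.rpow_le_rpow_of_exponent_le (by norm_num) ha
          rw [div_mul_eq_mul_div, div_le_iff₀ (by positivity)]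
          gcongr
        nlinarith
  intro T hT
  obtain ⟨n, hn⟩ := pow_unbounded_of_one_lt T (one_lt_two)
  exact key n T hT hn.le

lemma poly_exp (p : Polynomial ℝ) (δ : ℝ) (hδ : 0 < δ) :
    ∃ C > 0, ∀ u, 0 ≤ u → |p.eval u| ≤ C * Real.exp (δ * u) := by
  set q := p.comp (Polynomial.C δ⁻¹ * Polynomial.X) with hq
  have ht := q.tendsto_div_exp_atTop
  have hev : ∀ᶠ x in Filter.atTop, |q.eval x / Real.exp x| ≤ 1 := by
    have := ht.abs
    rw [abs_zero] at this
    exact this.eventually_le_const (by norm_num)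
  obtain ⟨X, hX⟩ := Filter.eventually_atTop.1 hev
  obtain ⟨B, hB⟩ := (isCompact_Icc (a := (0:ℝ)) (b := X)).exists_bound_of_continuousOn
    (f := fun x => q.eval x / Real.exp x) (by
      apply Continuous.continuousOn
      exact q.continuous.div Real.continuous_exp (fun x => (Real.exp_pos x).ne'))
  have hall : ∀ x, 0 ≤ x → |q.eval x / Real.exp x| ≤ |B| + 1 := by
    intro x hx
    by_cases h : x ≤ X
    · have := hB x ⟨hx, h⟩
      rw [Real.norm_eq_abs] at this
      linarith [le_abs_self B]
    · have := hX x (not_le.1 h).le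
      linarith [abs_nonneg B]
  refine ⟨|B| + 1, by positivity, fun u hu => ?_⟩
  have := hall (δ * u) (by positivity)
  rw [abs_div, abs_of_pos (Real.exp_pos _), div_le_iff₀ (Real.exp_pos _)] at this
  have e : q.eval (δ * u) = p.eval u := by
    rw [hq]; simp only [Polynomial.eval_comp, Polynomial.eval_mul, Polynomial.eval_C, Polynomial.eval_X]
    congr 1; field_simp
  rwa [e] at this

lemma E2_facts (P4 : Polynomial ℝ) (E2 : ℝ → ℝ)
    (hE2 : ∀ T : ℝ, E2 T =
      (∫ t in (0:ℝ)..T, ‖riemannZeta (1/2 + Complex.I * t)‖ ^ 4)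
        - T * P4.eval (Real.log T))
    (hpt : ∀ ε > 0, ∃ C > 0, ∀ T : ℝ, 2 ≤ T → |E2 T| ≤ C * T ^ ((2:ℝ)/3 + ε))
    (hms : ∃ C > 0, ∃ A > 0, ∀ T : ℝ, 2 ≤ T →
      (∫ t in (1:ℝ)..T, (E2 t) ^ 2) ≤ A * T ^ 2 * Real.log T ^ C)
    (δ : ℝ) (hδ : 0 < δ) :
    ∃ M : ℝ → ℝ, ∃ A : ℝ, 1 ≤ A ∧ Continuous (fun u => E2 (Real.exp u)) ∧ Continuous M ∧
    (∀ u, 0 ≤ u → |E2 (Real.exp u)| ≤ A * Real.exp ((2/3 + δ) * u)) ∧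
    (∀ u, 0 ≤ u → 0 ≤ M u) ∧ (∀ u, 0 ≤ u → M u ≤ A * Real.exp ((1 + δ) * u)) ∧
    (∀ u v, 0 ≤ u → u ≤ v → |E2 (Real.exp v) - E2 (Real.exp u)| ≤ M v - M u) ∧
    (∀ u, 0 ≤ u → ∫ w in (0:ℝ)..u, E2 (Real.exp w) ^ 2 * Real.exp w ≤ A * Real.exp ((2 + δ) * u)) := by
  have hzc : Continuous (fun t : ℝ => ‖riemannZeta (1/2 + Complex.I * t)‖ ^ 4) := by
    refine Continuous.pow (Continuous.norm ?_) 4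
    rw [continuous_iff_continuousAt]
    intro t
    have hne : (1/2 + Complex.I * t : ℂ) ≠ 1 := by
      intro h
      have := congrArg Complex.re h
      norm_num at this
    exact ContinuousAt.comp (f := fun t : ℝ => (1/2 + Complex.I * t : ℂ)) (differentiableAt_riemannZeta hne).continuousAt (by fun_prop)
  set z : ℝ → ℝ := fun t : ℝ => ‖riemannZeta (1/2 + Complex.I * t)‖ ^ 4 with hz
  have hz0 : ∀ t, 0 ≤ z t := fun t => by positivity
  have zi : ∀ a b, IntervalIntegrable z volume a b := fun a b => hzc.intervalIntegrable _ _
  set F : ℝ → ℝ := fun x => ∫ t in (0:ℝ)..x, z t with hF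
  have hFc : Continuous F := intervalIntegral.continuous_primitive zi 0
  have hFm : ∀ x y, x ≤ y → F x ≤ F y := by
    intro x y hxy
    have := intervalIntegral.integral_add_adjacent_intervals (zi 0 x) (zi x y)
    have h2 : 0 ≤ ∫ t in x..y, z t := intervalIntegral.integral_nonneg hxy (fun t _ => hz0 t)
    simp only [hF]; linarith
  have hF0 : ∀ x, 0 ≤ x → 0 ≤ F x := fun x hx => intervalIntegral.integral_nonneg hx (fun t _ => hz0 t)
  have hee : ∀ u, E2 (Real.exp u) = F (Real.exp u) - Real.exp u * P4.eval u := by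
    intro u; rw [hE2, Real.log_exp]
  have hec : Continuous (fun u => E2 (Real.exp u)) := by
    simp only [hee]
    have := P4.continuous
    fun_prop
  -- polynomial bounds
  obtain ⟨C1, hC1, hP1⟩ := poly_exp P4 δ hδ
  obtain ⟨C2, hC2, hP2⟩ := poly_exp (P4 + P4.derivative) δ hδ
  -- pointwise
  obtain ⟨C3, hC3, hp3⟩ := hpt δ hδ
  obtain ⟨B3, hB3⟩ := (isCompact_Icc (a := (0:ℝ)) (b := Real.log 2)).exists_bound_of_continuousOn hec.continuousOn
  have hpb : ∀ u, 0 ≤ u → |E2 (Real.exp u)| ≤ (C3 + |B3|) * Real.exp ((2/3 + δ) * u) := by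
    intro u hu
    have e1 : 1 ≤ Real.exp ((2/3 + δ) * u) := Real.one_le_exp (by positivity)
    by_cases h : u ≤ Real.log 2
    · have := hB3 u ⟨hu, h⟩
      rw [Real.norm_eq_abs] at this
      nlinarith [le_abs_self B3, abs_nonneg B3]
    · have h2 : 2 ≤ Real.exp u := by
        rw [← Real.log_le_iff_le_exp (by norm_num)]; exact (not_le.1 h).le
      have := hp3 _ h2
      rw [← Real.exp_mul, mul_comm u] at this
      nlinarith [abs_nonneg B3]
  -- mean square
  obtain ⟨c, hc, A0, hA0, hm⟩ := hms
  have hsub : ∀ u, ∫ w in (0:ℝ)..u, E2 (Real.exp w) ^ 2 * Real.exp w = ∫ t in (1:ℝ)..(Real.exp u), (E2 t)^2 := by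
    intro u
    have := intervalIntegral.integral_comp_mul_deriv' (a := 0) (b := u) (f := Real.exp) (f' := Real.exp) (g := fun t => (E2 t)^2)
      (fun x _ => Real.hasDerivAt_exp x) Real.continuous_exp.continuousOn ?_
    · rw [Real.exp_zero] at this; exact this
    · have h1 : ContinuousOn (fun x => (fun u => E2 (Real.exp u)) (Real.log x)) (Real.exp '' Set.uIcc 0 u) := by
        apply hec.comp_continuousOn
        apply Real.continuousOn_log.mono
        rintro _ ⟨y, _, rfl⟩
        exact (Real.exp_pos y).ne'
      refine (h1.congr ?_).pow 2
      rintro _ ⟨y, _, rfl⟩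
      simp only [Real.log_exp]
  set m : ℝ → ℝ := fun u => ∫ w in (0:ℝ)..u, E2 (Real.exp w) ^ 2 * Real.exp w with hmd
  have hmb : ∃ C4 > 0, ∀ u, 0 ≤ u → m u ≤ C4 * Real.exp ((2 + δ) * u) := by
    have mi : ∀ a b, IntervalIntegrable (fun w => E2 (Real.exp w) ^ 2 * Real.exp w) volume a b :=
      fun a b => Continuous.intervalIntegrable ((hec.pow 2).mul Real.continuous_exp) _ _
    set K4 := A0 * (1 / (δ/c)) ^ c with hK4
    have hK40 : 0 < K4 := by positivity
    have big : ∀ u, Real.log 2 ≤ u → m u ≤ K4 * Real.exp ((2 + δ) * u) := by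
      intro u hu
      have hu0 : 0 ≤ u := (Real.log_nonneg (by norm_num)).trans hu
      have h2 : 2 ≤ Real.exp u := by
        rw [← Real.log_le_iff_le_exp (by norm_num)]; exact hu
      have := hm _ h2
      rw [← hsub u, Real.log_exp] at this
      refine this.trans ?_
      have l1 : u ≤ (1 / (δ/c)) * Real.exp ((δ/c) * u) := by
        have := Real.add_one_le_exp ((δ/c) * u)
        rw [one_div, ← div_eq_inv_mul, le_div_iff₀ (by positivity)]
        linarith
      have l2 : u ^ c ≤ (1 / (δ/c)) ^ c * Real.exp (δ * u) := by
        refine (pow_le_pow_left₀ hu0 l1 c).trans (le_of_eq ?_)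
        have hc' : (c:ℝ) ≠ 0 := by positivity
        rw [mul_pow, ← Real.exp_nat_mul]
        congr 2; field_simp
      have l3 : Real.exp ((2+δ) * u) = Real.exp u ^ 2 * Real.exp (δ * u) := by
        rw [← Real.exp_nat_mul, ← Real.exp_add]; congr 1; push_cast; ring
      rw [l3, hK4]
      calc A0 * Real.exp u ^ 2 * u ^ c ≤ A0 * Real.exp u ^ 2 * ((1 / (δ/c)) ^ c * Real.exp (δ * u)) := by gcongr
        _ = _ := by ring
    refine ⟨K4 * Real.exp ((2+δ) * Real.log 2), by positivity, fun u hu => ?_⟩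
    by_cases h : Real.log 2 ≤ u
    · refine (big u h).trans ?_
      have : 1 ≤ Real.exp ((2+δ) * Real.log 2) := Real.one_le_exp (by positivity)
      apply mul_le_mul_of_nonneg_right _ (Real.exp_pos _).le
      nlinarith
    · have h' := (not_le.1 h).le
      have s1 : m u ≤ m (Real.log 2) := by
        have := intervalIntegral.integral_add_adjacent_intervals (mi 0 u) (mi u (Real.log 2))
        have h2 : 0 ≤ ∫ w in u..(Real.log 2), E2 (Real.exp w) ^ 2 * Real.exp w :=
          intervalIntegral.integral_nonneg h' (fun t _ => by positivity)
        simp only [hmd]; linarith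
      refine s1.trans ((big _ le_rfl).trans ?_)
      exact le_mul_of_one_le_right (by positivity) (Real.one_le_exp (by positivity))
  obtain ⟨C4, hC4, hmb⟩ := hmb
  set A := 1 + (C3 + |B3|) + (C3 + |B3| + C1 + C2) + C4 with hA
  have hB3' := abs_nonneg B3
  refine ⟨fun u => F (Real.exp u) + C2 * Real.exp ((1+δ) * u), A, by rw [hA]; linarith, hec, by fun_prop, ?_, ?_, ?_, ?_, ?_⟩
  · intro u hu
    refine (hpb u hu).trans ?_
    apply mul_le_mul_of_nonneg_right _ (Real.exp_pos _).le
    rw [hA]; linarith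
  · intro u hu
    have := hF0 (Real.exp u) (Real.exp_pos _).le
    positivity
  · intro u hu
    have h1 : F (Real.exp u) = E2 (Real.exp u) + Real.exp u * P4.eval u := by rw [hee]; ring
    have h2 : E2 (Real.exp u) ≤ (C3 + |B3|) * Real.exp ((1 + δ) * u) := by
      refine (le_abs_self _).trans ((hpb u hu).trans ?_)
      apply mul_le_mul_of_nonneg_left _ (by positivity)
      apply Real.exp_le_exp.2; nlinarith
    have h3 : Real.exp u * P4.eval u ≤ C1 * Real.exp ((1+δ) * u) := by
      have e : Real.exp ((1+δ) * u) = Real.exp u * Real.exp (δ * u) := by rw [← Real.exp_add]; ring_nf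
      have := (le_abs_self _).trans (hP1 u hu)
      rw [e]
      nlinarith [mul_le_mul_of_nonneg_left this (Real.exp_pos u).le]
    have h4 := Real.exp_pos ((1+δ) * u)
    show F (Real.exp u) + C2 * Real.exp ((1+δ) * u) ≤ _
    rw [h1, hA]
    nlinarith
  · -- difference bound
    have hqd : ∀ x, HasDerivAt (fun u => Real.exp u * P4.eval u) (Real.exp x * (P4 + P4.derivative).eval x) x := by
      intro x
      have := (Real.hasDerivAt_exp x).mul (P4.hasDerivAt x)
      rw [Polynomial.eval_add, mul_add]; exact this
    have hQd : ∀ x, HasDerivAt (fun u => C2 * Real.exp ((1+δ) * u)) (C2 * (Real.exp ((1+δ) * x) * (1+δ))) x := by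
      intro x
      have := (((hasDerivAt_id x).const_mul (1+δ)).exp).const_mul C2
      simpa using this
    have hder : ∀ x, 0 ≤ x → |Real.exp x * (P4 + P4.derivative).eval x| ≤ C2 * (Real.exp ((1+δ) * x) * (1+δ)) := by
      intro x hx
      have e : Real.exp ((1+δ) * x) = Real.exp x * Real.exp (δ * x) := by rw [← Real.exp_add]; ring_nf
      rw [abs_mul, abs_of_pos (Real.exp_pos x), e]
      have := mul_le_mul_of_nonneg_left (hP2 x hx) (Real.exp_pos x).le
      have h2 : 0 ≤ C2 * (Real.exp x * Real.exp (δ * x)) * δ := by positivity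
      nlinarith
    have mono : ∀ s : ℝ, |s| ≤ 1 → MonotoneOn (fun u => C2 * Real.exp ((1+δ) * u) + s * (Real.exp u * P4.eval u)) (Set.Ici 0) := by
      intro s hs
      have hd : ∀ x, HasDerivAt (fun u => C2 * Real.exp ((1+δ) * u) + s * (Real.exp u * P4.eval u)) (C2 * (Real.exp ((1+δ) * x) * (1+δ)) + s * (Real.exp x * (P4 + P4.derivative).eval x)) x :=
        fun x => (hQd x).add ((hqd x).const_mul s)
      apply monotoneOn_of_deriv_nonneg (convex_Ici 0)
      · exact fun x _ => (hd x).continuousAt.continuousWithinAt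
      · exact fun x _ => (hd x).differentiableAt.differentiableWithinAt
      · intro x hx
        rw [interior_Ici] at hx
        rw [(hd x).deriv]
        have h1 := hder x (le_of_lt hx)
        have h2 : |s * (Real.exp x * (P4 + P4.derivative).eval x)| ≤ |Real.exp x * (P4 + P4.derivative).eval x| := by
          rw [abs_mul]; exact mul_le_of_le_one_left (abs_nonneg _) hs
        have h3 := neg_abs_le (s * (Real.exp x * (P4 + P4.derivative).eval x))
        linarith
    intro u v hu huv
    have m1 := mono 1 (by simp) hu (hu.trans huv) huv
    have m2 := mono (-1) (by simp) hu (hu.trans huv) huv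
    have m3 := hFm _ _ (Real.exp_le_exp.2 huv)
    simp only at m1 m2
    rw [hee, hee, abs_le]
    constructor <;> simp only <;> linarith
  · intro u hu
    refine (hmb u hu).trans ?_
    apply mul_le_mul_of_nonneg_right _ (Real.exp_pos _).le
    rw [hA]; linarith

lemma cov (E2 : ℝ → ℝ) (σ t : ℝ) :
    ∫ x in Set.Ioi (1:ℝ), (((E2 x) ^ 2 : ℝ) : ℂ) * (x : ℂ) ^ (-(σ + Complex.I * t) - 1)
    = ∫ u in Set.Ioi (0:ℝ), ((E2 (Real.exp u) ^ 2 * Real.exp (-σ * u) : ℝ) : ℂ) * cexp (-(I * t * u)) := by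
  have himg : Real.exp '' Set.Ioi 0 = Set.Ioi 1 := by
    ext x
    constructor
    · rintro ⟨y, hy, rfl⟩
      exact Real.one_lt_exp_iff.2 hy
    · intro hx
      have hx' : 1 < x := hx
      exact ⟨Real.log x, Real.log_pos hx', Real.exp_log (by linarith)⟩
  rw [← himg, integral_image_eq_integral_abs_deriv_smul measurableSet_Ioi
    (fun x _ => (Real.hasDerivAt_exp x).hasDerivWithinAt) Real.exp_injective.injOn]
  congr 1; funext u
  rw [abs_of_pos (Real.exp_pos u), Complex.cpow_def_of_ne_zero (by exact_mod_cast (Real.exp_pos u).ne'),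
    ← Complex.ofReal_log (Real.exp_pos u).le, Real.log_exp, Complex.real_smul]
  push_cast
  have : cexp (u * (-(σ + I * t) - 1)) = cexp (-u) * (cexp (-σ * u) * cexp (-(I * t * u))) := by
    rw [← Complex.exp_add, ← Complex.exp_add]; congr 1; ring
  have h2 : cexp u * cexp (-u) = 1 := by rw [← Complex.exp_add]; simp
  rw [this]
  linear_combination ((E2 (Real.exp u) : ℂ)^2 * (cexp (-σ * u) * cexp (-(I * t * u)))) * h2

theorem stmt_12
    (P4 : Polynomial ℝ) (hdeg : P4.degree = 4)
    (hlead : P4.leadingCoeff = 1 / (2 * Real.pi ^ 2))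
    (E2 : ℝ → ℝ)
    (hE2 : ∀ T : ℝ, E2 T =
      (∫ t in (0:ℝ)..T, ‖riemannZeta (1/2 + Complex.I * t)‖ ^ 4)
        - T * P4.eval (Real.log T))
    (hpt : ∀ ε > 0, ∃ C > 0, ∀ T : ℝ, 2 ≤ T → |E2 T| ≤ C * T ^ ((2:ℝ)/3 + ε))
    (hms : ∃ C > 0, ∃ A > 0, ∀ T : ℝ, 2 ≤ T →
      (∫ t in (1:ℝ)..T, (E2 t) ^ 2) ≤ A * T ^ 2 * Real.log T ^ C)
    (K : ℂ → ℂ)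
    (hK : ∀ s : ℂ, 1 < s.re → K s =
      -(1/2 : ℂ) * ((E2 1 : ℝ) : ℂ) ^ 2 -
        (1/2 : ℂ) * s * ∫ x in Set.Ioi (1:ℝ), (((E2 x) ^ 2 : ℝ) : ℂ) * (x : ℂ) ^ (-s - 1))
    (σ : ℝ) (hσ1 : 1 < σ) (hσ2 : σ ≤ 3/2) (ε : ℝ) (hε : 0 < ε) :
    ∃ C > 0, ∀ T : ℝ, 2 ≤ T →
      (∫ t in (1:ℝ)..T, ‖K (σ + Complex.I * t)‖ ^ 2)
        ≤ C * T ^ ((33 - 18 * σ) / 5 + ε) := by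
  set δ := min (ε/8) ((σ-1)/2) with hδd
  have hδ : 0 < δ := lt_min (by positivity) (by linarith)
  have hδ1 : δ ≤ ε/8 := min_le_left _ _
  have hδ2 : δ ≤ (σ-1)/2 := min_le_right _ _
  obtain ⟨M, A, hA, hec, hMc, heb, hM0, hM1, hd, hmb⟩ := E2_facts P4 E2 hE2 hpt hms δ hδ
  obtain ⟨hGc, C, hC, hG⟩ := abstract_main (fun u => E2 (Real.exp u)) M hec hMc A σ δ hA hσ1 hσ2 hδ hδ2 heb hM0 hM1 hd hmb
  set G : ℝ → ℂ := fun t : ℝ => ∫ u in Set.Ioi (0:ℝ), ((E2 (Real.exp u) ^ 2 * Real.exp (-σ * u) : ℝ) : ℂ) * cexp (-(I * t * u)) with hGd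
  set c0 : ℂ := -(1/2 : ℂ) * ((E2 1 : ℝ) : ℂ) ^ 2 with hc0
  have hKe : ∀ t : ℝ, K (σ + I * t) = c0 - (1/2 : ℂ) * (σ + I * t) * G t := by
    intro t
    rw [hK _ (by simpa using hσ1), cov]
  have hKc : Continuous (fun t : ℝ => ‖K (σ + I * t)‖^2) := by
    simp only [hKe]; fun_prop
  set a := (33 - 18 * σ) / 5 + ε with ha
  have ha1 : 1 ≤ a := by rw [ha]; linarith
  set C' := 2 * ‖c0‖^2 + 8 * C with hC'
  have hC'0 : 0 < C' := by positivity
  refine ⟨C', hC'0, fun T hT => ?_⟩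
  refine dyadic _ hKc (fun t => by positivity) C' a hC'0 ha1 ?_ T (by linarith)
  intro U hU
  have hU0 : 0 < U := by linarith
  have hptK : ∀ t, U ≤ t → t ≤ 2 * U → ‖K (σ + I * t)‖^2 ≤ 2 * ‖c0‖^2 + 8 * U^2 * ‖G t‖^2 := by
    intro t h1 h2
    rw [hKe]
    have hs : ‖(σ + I * t : ℂ)‖ ≤ 4 * U := by
      refine (norm_add_le _ _).trans ?_
      rw [norm_mul, Complex.norm_I, one_mul, Complex.norm_real, Complex.norm_real,
        Real.norm_of_nonneg (by linarith), Real.norm_of_nonneg (by linarith)]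
      linarith
    have h3 : ‖c0 - (1/2 : ℂ) * (σ + I * t) * G t‖ ≤ ‖c0‖ + 2 * U * ‖G t‖ := by
      refine (norm_sub_le _ _).trans ?_
      rw [norm_mul ((1/2 : ℂ) * (σ + I * t)) (G t), norm_mul (1/2 : ℂ) (σ + I * t)]
      have : ‖(1/2 : ℂ)‖ = 1/2 := by norm_num
      rw [this]
      have := mul_le_mul_of_nonneg_right hs (norm_nonneg (G t))
      linarith
    have := pow_le_pow_left₀ (norm_nonneg _) h3 2
    nlinarith [sq_nonneg (‖c0‖ - 2 * U * ‖G t‖)]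
  have s1 : ∫ t in U..(2*U), ‖K (σ + I * t)‖^2 ≤ ∫ t in U..(2*U), (2 * ‖c0‖^2 + 8 * U^2 * ‖G t‖^2) := by
    apply intervalIntegral.integral_mono_on (by linarith) (hKc.intervalIntegrable _ _) (Continuous.intervalIntegrable (by fun_prop) _ _)
    intro t ht; exact hptK t ht.1 ht.2
  rw [intervalIntegral.integral_add (by simp) (Continuous.intervalIntegrable (by fun_prop) _ _),
    intervalIntegral.integral_const, smul_eq_mul, intervalIntegral.integral_const_mul] at s1
  have r1 : U ≤ U ^ a := by
    conv_lhs => rw [← Real.rpow_one U]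
    exact Real.rpow_le_rpow_of_exponent_le hU ha1
  have r2 : U^2 * U ^ (5 - 4 * σ + 8 * δ) ≤ U ^ a := by
    rw [← Real.rpow_natCast U 2, ← Real.rpow_add hU0]
    apply Real.rpow_le_rpow_of_exponent_le hU
    rw [ha]; push_cast; linarith
  have hGU := hG U hU
  calc _ ≤ _ := s1
    _ = 2 * ‖c0‖^2 * U + 8 * (U^2 * ∫ t in U..(2*U), ‖G t‖^2) := by ring
    _ ≤ 2 * ‖c0‖^2 * U + 8 * (U^2 * (C * U ^ (5 - 4 * σ + 8 * δ))) := by gcongr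
    _ = 2 * ‖c0‖^2 * U + 8 * C * (U^2 * U ^ (5 - 4 * σ + 8 * δ)) := by ring
    _ ≤ 2 * ‖c0‖^2 * U ^ a + 8 * C * U ^ a := by gcongr
    _ = _ := by rw [hC']; ring
end

section
/- Assume that for every ε > 0 one has ∫_1^X |ζ(1/2+ix)|⁸ dx ≪_ε X^{3/2+ε} for all X ≥ 2. Let σ be fixed with 1/2 < σ ≤ 5/4. Then for every ε > 0, all X ≥ 2 and all T > 0, ∫_0^T |∫_1^X |ζ(1/2+ix)|⁴ x^{−σ−it} dx|² dt ≪_{σ,ε} X^{5/2−2σ+ε}, uniformly in T. -/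
open MeasureTheory Complex

lemma aux_coeff (f : ℝ → ℂ) (L : ℝ) (hL : 0 < L) (s : ℝ) (n : ℤ) :
    (∫ u in (0:ℝ)..L, f u * cexp (-(I * ((s + n * (2 * Real.pi / L) : ℝ) : ℂ) * u)))
      = (L : ℂ) * fourierCoeffOn hL (fun u => f u * cexp (-(I * s * u))) n := by
  rw [fourierCoeffOn_eq_integral]
  have hL' : (L : ℂ) ≠ 0 := by exact_mod_cast hL.ne'
  simp only [sub_zero, smul_eq_mul, Complex.real_smul]
  rw [← mul_assoc]
  push_cast
  rw [mul_one_div_cancel hL', one_mul]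
  apply intervalIntegral.integral_congr
  intro u _
  simp only [fourier_coe_apply]
  rw [mul_left_comm, ← Complex.exp_add]
  congr 2
  push_cast
  field_simp
  ring

lemma aux_planch (f : ℝ → ℂ) (hf : Continuous f) (L : ℝ) (hL : 0 < L) (T : ℝ) (hT : 0 < T) :
    (∫ t in (0:ℝ)..T, ‖∫ u in (0:ℝ)..L, f u * cexp (-(I * (t : ℂ) * u))‖ ^ 2)
      ≤ 2 * Real.pi * ∫ u in (0:ℝ)..L, ‖f u‖ ^ 2 := by
  set F : ℝ → ℝ := fun t => ‖∫ u in (0:ℝ)..L, f u * cexp (-(I * (t : ℂ) * u))‖ ^ 2 with hF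
  have hFc : Continuous F := by
    apply Continuous.pow
    apply Continuous.norm
    apply intervalIntegral.continuous_parametric_intervalIntegral_of_continuous'
    simp only [Function.uncurry_def]
    fun_prop
  have hF0 : ∀ t, 0 ≤ F t := fun t => by positivity
  set p := 2 * Real.pi / L with hp
  have hp0 : 0 < p := by positivity
  set J := ∫ u in (0:ℝ)..L, ‖f u‖ ^ 2 with hJ
  have key : ∀ s : ℝ, ∀ N : ℕ, ∑ k ∈ Finset.range N, F (s + k * p) ≤ L * J := by
    intro s N
    have hg : Continuous (fun u : ℝ => f u * cexp (-(I * s * u))) := by fun_prop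
    have hm : MemLp (fun u : ℝ => f u * cexp (-(I * s * u))) 2 (volume.restrict (Set.Ioc 0 L)) := by
      rw [memLp_two_iff_integrable_sq_norm hg.aestronglyMeasurable]
      have h1 : Continuous (fun u : ℝ => ‖f u * cexp (-(I * s * u))‖ ^ 2) := by fun_prop
      exact h1.integrableOn_Ioc
    have hs := hasSum_sq_fourierCoeffOn hL hm
    have hn : ∀ u : ℝ, ‖f u * cexp (-(I * s * u))‖ = ‖f u‖ := by
      intro u
      rw [norm_mul, Complex.norm_exp]
      simp
    simp only [hn, sub_zero, smul_eq_mul] at hs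
    have hb : ∑ k ∈ Finset.range N, ‖fourierCoeffOn hL (fun u : ℝ => f u * cexp (-(I * s * u))) (k:ℤ)‖ ^ 2 ≤ L⁻¹ * J := by
      have := sum_le_hasSum ((Finset.range N).map ⟨(fun k : ℕ => (k:ℤ)), Nat.cast_injective⟩) (fun i _ => by positivity) hs
      simpa using this
    have : ∀ k : ℕ, F (s + k * p) = L ^ 2 * ‖fourierCoeffOn hL (fun u : ℝ => f u * cexp (-(I * s * u))) (k:ℤ)‖ ^ 2 := by
      intro k
      have := aux_coeff f L hL s (k:ℤ)
      simp only [hF]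
      simp only [Int.cast_natCast] at this
      rw [hp, this, norm_mul, mul_pow]
      simp
    simp only [this, ← Finset.mul_sum]
    calc _ ≤ L ^ 2 * (L⁻¹ * J) := by gcongr
      _ = L * J := by field_simp
  obtain ⟨N, hN⟩ := exists_nat_ge (T / p)
  have hTN : T ≤ N * p := by rwa [div_le_iff₀ hp0] at hN
  have hii : ∀ a b, IntervalIntegrable F volume a b := fun a b => hFc.intervalIntegrable a b
  calc ∫ t in (0:ℝ)..T, F t ≤ ∫ t in (0:ℝ)..(N * p), F t :=
        intervalIntegral.integral_mono_interval le_rfl hT.le hTN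
          (Filter.Eventually.of_forall hF0) (hii _ _)
    _ = ∑ k ∈ Finset.range N, ∫ t in (k * p : ℝ)..((k + 1 : ℕ) * p), F t := by
        rw [intervalIntegral.sum_integral_adjacent_intervals (a := fun k : ℕ => (k:ℝ) * p)
          (fun k _ => hii _ _)]
        simp
    _ = ∑ k ∈ Finset.range N, ∫ s in (0:ℝ)..p, F (s + k * p) := by
        refine Finset.sum_congr rfl fun k _ => ?_
        rw [intervalIntegral.integral_comp_add_right]
        congr 1
        · ring
        · push_cast; ring
    _ = ∫ s in (0:ℝ)..p, ∑ k ∈ Finset.range N, F (s + k * p) := by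
        rw [intervalIntegral.integral_finsetSum]
        intro k _
        exact (hFc.comp (by fun_prop)).intervalIntegrable _ _
    _ ≤ ∫ s in (0:ℝ)..p, L * J := by
        apply intervalIntegral.integral_mono_on hp0.le
        · apply Continuous.intervalIntegrable
          fun_prop
        · simp
        · intro s _
          exact key s N
    _ = 2 * Real.pi * J := by
        rw [intervalIntegral.integral_const, hp]
        simp only [sub_zero, smul_eq_mul]
        field_simp

lemma aux_weight (g : ℝ → ℝ) (hg : Continuous g) (hg0 : ∀ x, 0 ≤ g x) (a b C : ℝ) (ha : 0 < a)
    (hab : a < b) (hC : 0 < C)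
    (h : ∀ X : ℝ, 2 ≤ X → (∫ x in (1:ℝ)..X, g x) ≤ C * X ^ b) (X : ℝ) (hX : 2 ≤ X) :
    (∫ x in (1:ℝ)..X, g x * x ^ (-a)) ≤ (C * 2 ^ b * (1 + a / (b - a))) * X ^ (b - a) := by
  set G : ℝ → ℝ := fun y => ∫ x in (1:ℝ)..y, g x with hG
  have hb : 0 < b := ha.trans hab
  have h2b : (1:ℝ) ≤ 2 ^ b := Real.one_le_rpow (by norm_num) hb.le
  have hGb : ∀ y, 1 ≤ y → G y ≤ C * 2 ^ b * y ^ b := by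
    intro y hy
    have hyb : 1 ≤ y ^ b := Real.one_le_rpow hy hb.le
    rcases le_total 2 y with h2 | h2
    · refine (h y h2).trans ?_
      rw [mul_assoc]
      gcongr
      nlinarith
    · have : G y ≤ G 2 := intervalIntegral.integral_mono_interval le_rfl hy h2
          (Filter.Eventually.of_forall hg0) (hg.intervalIntegrable _ _)
      refine (this.trans (h 2 le_rfl)).trans ?_
      have : 0 < C * 2 ^ b := by positivity
      nlinarith
  have hd : ∀ x, HasDerivAt G (g x) x := fun x =>
    intervalIntegral.integral_hasDerivAt_right (hg.intervalIntegrable _ _)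
      (hg.stronglyMeasurableAtFilter _ _) hg.continuousAt
  have h1X : (1:ℝ) ≤ X := by linarith
  have hpos : ∀ x ∈ Set.uIcc 1 X, 0 < x := by
    intro x hx
    rw [Set.uIcc_of_le h1X] at hx
    linarith [hx.1]
  have hcr : ∀ r : ℝ, ContinuousOn (fun x : ℝ => x ^ r) (Set.uIcc 1 X) := fun r x hx =>
    (Real.continuousAt_rpow_const x r (Or.inl (hpos x hx).ne')).continuousWithinAt
  have hGc : Continuous G := continuous_iff_continuousAt.2 fun x => (hd x).continuousAt
  have parts := intervalIntegral.integral_deriv_mul_eq_sub (a := 1) (b := X)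
    (u := G) (v := fun x => x ^ (-a)) (u' := g) (v' := fun x => -a * x ^ (-a - 1))
    (fun x _ => hd x)
    (fun x hx => Real.hasDerivAt_rpow_const (Or.inl (hpos x hx).ne'))
    (hg.intervalIntegrable _ _) ((continuousOn_const.mul (hcr _)).intervalIntegrable)
  have i1 : IntervalIntegrable (fun x => g x * x ^ (-a)) volume 1 X :=
    (hg.continuousOn.mul (hcr _)).intervalIntegrable
  have i2 : IntervalIntegrable (fun x => G x * (-a * x ^ (-a - 1))) volume 1 X :=
    (hGc.continuousOn.mul (continuousOn_const.mul (hcr _))).intervalIntegrable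
  rw [intervalIntegral.integral_add i1 i2] at parts
  have hG1 : G 1 = 0 := by simp [hG]
  rw [hG1, zero_mul, sub_zero] at parts
  have e : (∫ x in (1:ℝ)..X, g x * x ^ (-a))
      = G X * X ^ (-a) + ∫ x in (1:ℝ)..X, -(G x * (-a * x ^ (-a - 1))) := by
    rw [intervalIntegral.integral_neg]; linarith
  rw [e]
  have hX0 : 0 < X := by linarith
  have t1 : G X * X ^ (-a) ≤ C * 2 ^ b * X ^ (b - a) := by
    rw [sub_eq_add_neg, Real.rpow_add hX0, ← mul_assoc]
    gcongr
    exact hGb X h1X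
  have t2 : (∫ x in (1:ℝ)..X, -(G x * (-a * x ^ (-a - 1))))
      ≤ ∫ x in (1:ℝ)..X, C * 2 ^ b * a * x ^ (b - a - 1) := by
    apply intervalIntegral.integral_mono_on h1X i2.neg
      ((continuousOn_const.mul (hcr _)).intervalIntegrable)
    intro x hx
    have hx0 : 0 < x := by linarith [hx.1]
    have : b - a - 1 = b + (-a - 1) := by ring
    change -(G x * (-a * x ^ (-a - 1))) ≤ C * 2 ^ b * a * x ^ (b - a - 1)
    rw [this, Real.rpow_add hx0]
    have h3 := mul_le_mul_of_nonneg_right (hGb x hx.1) (show 0 ≤ a * x ^ (-a - 1) by positivity)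
    linarith
  rw [intervalIntegral.integral_const_mul, integral_rpow (Or.inl (by linarith))] at t2
  have hba : 0 < b - a := by linarith
  have t3 : C * 2 ^ b * a * ((X ^ (b - a - 1 + 1) - 1 ^ (b - a - 1 + 1)) / (b - a - 1 + 1))
      ≤ C * 2 ^ b * (a / (b - a)) * X ^ (b - a) := by
    rw [Real.one_rpow, sub_add_cancel]
    have : C * 2 ^ b * (a / (b - a)) * X ^ (b - a) = C * 2 ^ b * a * (X ^ (b - a) / (b - a)) := by
      field_simp
    rw [this]
    gcongr
    linarith
  linarith

lemma aux_zeta : Continuous (fun x : ℝ => ‖riemannZeta (1/2 + Complex.I * x)‖) := by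
  refine Continuous.norm (continuous_iff_continuousAt.2 fun x => ?_)
  have h : (1/2 + Complex.I * x : ℂ) ≠ 1 := by
    intro h
    have := congrArg Complex.re h
    norm_num at this
  exact ContinuousAt.comp (f := fun x : ℝ => (1/2 + Complex.I * x : ℂ)) (differentiableAt_riemannZeta h).continuousAt
    (by fun_prop)

theorem stmt_17
    (hyp : ∀ ε > 0, ∃ C > 0, ∀ X : ℝ, 2 ≤ X →
      (∫ x in (1:ℝ)..X, ‖riemannZeta (1/2 + Complex.I * x)‖ ^ 8)
        ≤ C * X ^ ((3:ℝ)/2 + ε))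
    (σ : ℝ) (hσ1 : 1/2 < σ) (hσ2 : σ ≤ 5/4)
    (ε : ℝ) (hε : 0 < ε) :
    ∃ C > 0, ∀ X : ℝ, 2 ≤ X → ∀ T : ℝ, 0 < T →
      (∫ t in (0:ℝ)..T,
        ‖∫ x in (1:ℝ)..X,
            ((‖riemannZeta (1/2 + Complex.I * x)‖ ^ 4 : ℝ) : ℂ)
              * (x : ℂ) ^ (-(σ : ℂ) - Complex.I * t)‖ ^ 2)
        ≤ C * X ^ (5/2 - 2 * σ + ε) := by
  obtain ⟨C, hC, hCX⟩ := hyp ε hε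
  set z : ℝ → ℝ := fun x => ‖riemannZeta (1/2 + Complex.I * x)‖ with hz
  have hzc : Continuous z := aux_zeta
  have ha : 0 < 2 * σ - 1 := by linarith
  have hab : 2 * σ - 1 < 3 / 2 + ε := by linarith
  have hba : 0 < 3 / 2 + ε - (2 * σ - 1) := by linarith
  refine ⟨2 * Real.pi * (C * 2 ^ (3 / 2 + ε) * (1 + (2 * σ - 1) / (3 / 2 + ε - (2 * σ - 1)))),
    by positivity, fun X hX T hT => ?_⟩
  have hX0 : 0 < X := by linarith
  have hL : 0 < Real.log X := Real.log_pos (by linarith)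
  have hw := aux_weight (fun x => z x ^ 8) (hzc.pow 8) (fun x => by positivity)
    (2 * σ - 1) (3 / 2 + ε) C ha hab hC hCX X hX
  set f : ℝ → ℂ := fun u => ((z (Real.exp u) ^ 4 * Real.exp (u * (1 - σ)) : ℝ) : ℂ) with hf
  have hfc : Continuous f := by fun_prop
  have hp := aux_planch f hfc (Real.log X) hL T hT
  have sub : ∀ h : ℝ → ℂ, ContinuousOn h (Set.Ioi 0) → (∫ x in (1:ℝ)..X, h x) =
      ∫ u in (0:ℝ)..Real.log X, Real.exp u • h (Real.exp u) := by
    intro h hh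
    have := intervalIntegral.integral_deriv_smul_comp''' (a := 0) (b := Real.log X) (f := Real.exp)
      (f' := Real.exp) (g := h) Real.continuous_exp.continuousOn
      (fun x _ => (Real.hasDerivAt_exp x).hasDerivWithinAt) ?_ ?_ ?_
    · rw [Real.exp_zero, Real.exp_log hX0] at this
      exact this.symm
    · refine hh.mono ?_
      rintro _ ⟨u, _, rfl⟩
      exact Real.exp_pos u
    · refine (ContinuousOn.integrableOn_compact (isCompact_uIcc.image Real.continuous_exp) (hh.mono ?_))
      rintro _ ⟨u, _, rfl⟩
      exact Real.exp_pos u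
    · refine ContinuousOn.integrableOn_compact isCompact_uIcc ?_
      refine Real.continuous_exp.continuousOn.smul (hh.comp Real.continuous_exp.continuousOn ?_)
      intro u _
      exact Real.exp_pos u
  have e1 : ∀ t : ℝ, (∫ x in (1:ℝ)..X, ((z x ^ 4 : ℝ) : ℂ) * (x : ℂ) ^ (-(σ : ℂ) - Complex.I * t))
      = ∫ u in (0:ℝ)..Real.log X, f u * cexp (-(I * (t : ℂ) * u)) := by
    intro t
    rw [sub]
    · apply intervalIntegral.integral_congr
      intro u _
      simp only [hf, Complex.real_smul]
      rw [Complex.cpow_def_of_ne_zero (by exact_mod_cast (Real.exp_pos u).ne'),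
        ← Complex.ofReal_log (Real.exp_pos u).le, Real.log_exp]
      push_cast
      rw [mul_left_comm, ← Complex.exp_add, mul_assoc, ← Complex.exp_add]
      congr 2
      ring
    · apply ContinuousOn.mul (by fun_prop)
      intro x hx
      apply ContinuousAt.continuousWithinAt
      exact continuousAt_ofReal_cpow_const _ _ (Or.inr (ne_of_gt hx))
  have e2 : (∫ x in (1:ℝ)..X, z x ^ 8 * x ^ (-(2 * σ - 1))) = ∫ u in (0:ℝ)..Real.log X, ‖f u‖ ^ 2 := by
    have : ((∫ x in (1:ℝ)..X, z x ^ 8 * x ^ (-(2 * σ - 1)) : ℝ) : ℂ)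
        = ((∫ u in (0:ℝ)..Real.log X, ‖f u‖ ^ 2 : ℝ) : ℂ) := by
      rw [← intervalIntegral.integral_ofReal, ← intervalIntegral.integral_ofReal, sub]
      · apply intervalIntegral.integral_congr
        intro u _
        simp only [hf, Complex.norm_real, Real.norm_eq_abs, sq_abs, Complex.real_smul]
        rw [← Complex.ofReal_mul]
        congr 1
        rw [← Real.exp_mul, mul_pow, ← pow_mul, mul_left_comm, ← Real.exp_add, ← Real.exp_nat_mul]
        congr 2
        push_cast
        ring
      · intro x hx
        have := Real.continuousAt_rpow_const x (-(2 * σ - 1)) (Or.inl (ne_of_gt hx))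
        exact (Complex.continuous_ofReal.continuousAt.comp ((hzc.pow 8).continuousAt.mul this)).continuousWithinAt
    exact_mod_cast this
  have e3 := hp
  simp only [← e1] at e3
  refine e3.trans ?_
  rw [← e2]
  have : 5 / 2 - 2 * σ + ε = 3 / 2 + ε - (2 * σ - 1) := by ring
  rw [this]
  rw [mul_assoc (2 * Real.pi) (C * _ * _)]
  exact mul_le_mul_of_nonneg_left hw (by positivity)
end

section
/- Let σ > 7/6 be fixed. Then for every ε > 0, all X ≥ 2 and all T ≥ 2, ∫_T^{2T} |(σ+it) ∫_X^∞ E₂(x)² x^{−σ−1−it} dx|² dt ≪_{σ,ε} T² X^{7/3−2σ+ε}. -/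
open MeasureTheory Complex

open FourierTransform SchwartzMap in
theorem planch_aux (F : ℝ → ℂ) (h1 : Integrable F) (h2 : MemLp F 2) :
    Integrable (fun t => ‖𝓕 F t‖ ^ 2) ∧ ∫ t, ‖𝓕 F t‖ ^ 2 = ∫ u, ‖F u‖ ^ 2 := by
  set f : Lp ℂ 2 (volume : Measure ℝ) := h2.toLp F with hf
  have hcont : Continuous (𝓕 F) :=
    VectorFourier.fourierIntegral_continuous Real.continuous_fourierChar
      (by exact continuous_inner) h1
  have hae : ∀ᵐ x, (𝓕 f : Lp ℂ 2 (volume : Measure ℝ)) x = 𝓕 F x := by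
    apply ae_eq_of_integral_contDiff_smul_eq
    · exact (Lp.memLp _).locallyIntegrable (by norm_num)
    · exact hcont.locallyIntegrable
    · intro g hg hgc
      let G : 𝓢(ℝ, ℂ) := HasCompactSupport.toSchwartzMap (f := fun x => (g x : ℂ))
        (hgc.comp_left (g := fun x : ℝ => (x : ℂ)) (by simp)) (by
          exact Complex.ofRealCLM.contDiff.comp hg)
      have e1 := congrArg (fun D : TemperedDistribution ℝ ℂ => D G) (Lp.fourier_toTemperedDistribution_eq f)
      simp only [TemperedDistribution.fourier_apply, Lp.toTemperedDistribution_apply] at e1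
      have e2 : ∫ x, (𝓕 G) x • f x = ∫ x, (𝓕 (G : ℝ → ℂ)) x • F x := by
        apply integral_congr_ae
        filter_upwards [h2.coeFn_toLp] with x hx
        rw [hf, hx, SchwartzMap.fourier_coe]
      have e3 : ∫ x, (𝓕 (G : ℝ → ℂ)) x • F x = ∫ x, G x • 𝓕 F x := by
        simpa using! (VectorFourier.integral_fourierIntegral_smul_eq_flip (L := innerₗ ℝ)
          Real.continuous_fourierChar continuous_inner G.integrable h1)
      have := e1.symm.trans (e2.trans e3)
      exact this
  have hm : MemLp (𝓕 F) 2 := (memLp_congr_ae hae).1 (Lp.memLp _)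
  refine ⟨hm.integrable_norm_pow (by norm_num), ?_⟩
  have hn := Lp.norm_fourier_eq f
  have k1 : ∫ t, ‖𝓕 F t‖ ^ 2 = ‖(𝓕 f : Lp ℂ 2 (volume : Measure ℝ))‖ ^ 2 := by
    rw [← inner_self_eq_norm_sq (𝕜 := ℂ), L2.inner_def, ← integral_re]
    · apply integral_congr_ae
      filter_upwards [hae] with x hx
      rw [hx, inner_self_eq_norm_sq]
    · exact L2.integrable_inner _ _
  have k2 : ∫ t, ‖F t‖ ^ 2 = ‖f‖ ^ 2 := by
    rw [← inner_self_eq_norm_sq (𝕜 := ℂ), L2.inner_def, ← integral_re]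
    · apply integral_congr_ae
      filter_upwards [h2.coeFn_toLp] with x hx
      rw [hx, inner_self_eq_norm_sq]
    · exact L2.integrable_inner _ _
  rw [k1, k2, hn]

open FourierTransform in
theorem mp_aux (f : ℝ → ℝ) (σ X : ℝ) (hX : 0 < X)
    (h1 : IntegrableOn (fun x => f x * x ^ (-σ - 1)) (Set.Ioi X))
    (h2 : IntegrableOn (fun x => f x ^ 2 * x ^ (-2 * σ - 1)) (Set.Ioi X)) :
    Integrable (fun t : ℝ => ‖∫ x in Set.Ioi X, (f x : ℂ) * (x : ℂ) ^ (-(σ : ℂ) - 1 - I * t)‖ ^ 2) ∧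
    ∫ t : ℝ, ‖∫ x in Set.Ioi X, (f x : ℂ) * (x : ℂ) ^ (-(σ : ℂ) - 1 - I * t)‖ ^ 2
      = 2 * Real.pi * ∫ x in Set.Ioi X, f x ^ 2 * x ^ (-2 * σ - 1) := by
  obtain ⟨L, rfl⟩ : ∃ L, X = Real.exp L := ⟨Real.log X, (Real.exp_log hX).symm⟩
  have hr : ∀ u c : ℝ, Real.exp u ^ c = Real.exp (u * c) := fun u c => (Real.exp_mul u c).symm
  let k : ℝ → ℝ := fun u => f (Real.exp u) * Real.exp (-σ * u)
  have hk1 : IntegrableOn k (Set.Ioi L) := by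
    rw [← integrableOn_comp_exp_Ioi] at h1
    refine h1.congr_fun (fun u _ => ?_) measurableSet_Ioi
    simp only [k, smul_eq_mul, hr]
    rw [mul_left_comm, ← Real.exp_add]; ring_nf
  have hpt2 : ∀ u, Real.exp u • (f (Real.exp u) ^ 2 * Real.exp u ^ (-2 * σ - 1)) = k u ^ 2 := by
    intro u
    simp only [k, smul_eq_mul, hr]
    rw [mul_left_comm, ← Real.exp_add, mul_pow, ← Real.exp_nat_mul]; ring_nf
  have hk2 : IntegrableOn (fun u => k u ^ 2) (Set.Ioi L) := by
    rw [← integrableOn_comp_exp_Ioi] at h2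
    exact h2.congr_fun (fun u _ => hpt2 u) measurableSet_Ioi
  have hi2 : ∫ x in Set.Ioi (Real.exp L), f x ^ 2 * x ^ (-2 * σ - 1)
      = ∫ u in Set.Ioi L, k u ^ 2 := by
    rw [← integral_comp_exp_Ioi]
    exact setIntegral_congr_fun measurableSet_Ioi (fun u _ => hpt2 u)
  let F : ℝ → ℂ := (Set.Ioi L).indicator (fun u => (k u : ℂ))
  have hF1 : Integrable F := (integrable_indicator_iff measurableSet_Ioi).2 hk1.ofReal
  have hFn : ∀ u, ‖F u‖ ^ 2 = (Set.Ioi L).indicator (fun u => k u ^ 2) u := by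
    intro u
    simp only [F]
    by_cases h : u ∈ Set.Ioi L
    · simp only [Set.indicator_of_mem h, norm_real, Real.norm_eq_abs, sq_abs]
    · simp [Set.indicator_of_notMem h]
  have hF2 : MemLp F 2 := by
    rw [memLp_two_iff_integrable_sq_norm hF1.aestronglyMeasurable]
    simp_rw [hFn]
    exact (integrable_indicator_iff measurableSet_Ioi).2 hk2
  obtain ⟨P1, P2⟩ := planch_aux F hF1 hF2
  have hG : ∀ t : ℝ, ∫ x in Set.Ioi (Real.exp L), (f x : ℂ) * (x : ℂ) ^ (-(σ : ℂ) - 1 - I * t)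
      = 𝓕 F (t / (2 * Real.pi)) := by
    intro t
    rw [← integral_comp_exp_Ioi, Real.fourier_real_eq_integral_exp_smul, ← integral_indicator measurableSet_Ioi]
    congr 1
    ext u
    by_cases h : u ∈ Set.Ioi L
    · simp only [F, Set.indicator_of_mem h, k, smul_eq_mul, real_smul]
      push_cast
      have hc : Complex.exp (u:ℂ) ^ (-(σ : ℂ) - 1 - I * t)
          = Complex.exp ((u:ℂ) * (-(σ : ℂ) - 1 - I * t)) := by
        rw [cpow_def_of_ne_zero (Complex.exp_ne_zero _), ← ofReal_exp, ← ofReal_log (Real.exp_pos u).le,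
          Real.log_exp]
      have hpi : (Real.pi : ℂ) ≠ 0 := ofReal_ne_zero.2 Real.pi_ne_zero
      rw [hc, mul_left_comm, ← Complex.exp_add, mul_left_comm (Complex.exp _), ← Complex.exp_add]
      congr 2
      field_simp
      ring
    · simp [F, Set.indicator_of_notMem h]
  simp_rw [hG]
  constructor
  · exact P1.comp_div (by positivity)
  · rw [Measure.integral_comp_div (fun t => ‖𝓕 F t‖ ^ 2), P2, hi2]
    simp_rw [hFn]
    rw [integral_indicator measurableSet_Ioi, abs_of_pos (by positivity), smul_eq_mul]

theorem tail_aux (g : ℝ → ℝ) (hg : ContinuousOn g (Set.Ioi 0)) (hg0 : ∀ x, 0 ≤ g x)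
    (A p a : ℝ) (hA : 0 < A) (hp : 0 < p) (ha : p < a)
    (hM : ∀ T : ℝ, 2 ≤ T → ∫ t in (1:ℝ)..T, g t ≤ A * T ^ p) (X : ℝ) (hX : 2 ≤ X) :
    IntegrableOn (fun x => g x * x ^ (-a)) (Set.Ioi X) ∧
      ∫ x in Set.Ioi X, g x * x ^ (-a) ≤ (A + a * A / (a - p)) * X ^ (p - a) := by
  have ha0 : 0 < a := hp.trans ha
  have hX0 : 0 < X := by linarith
  have hcont : ContinuousOn (fun x => g x * x ^ (-a)) (Set.Ioi 0) :=
    hg.mul (continuousOn_id.rpow_const (fun x hx => Or.inl (ne_of_gt hx)))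
  have hsub : ∀ Y, X ≤ Y → Set.uIcc X Y ⊆ Set.Ioi 0 := by
    intro Y hY x hx
    rw [Set.uIcc_of_le hY] at hx
    exact hX0.trans_le hx.1
  have hder : ∀ x, 0 < x → HasDerivAt (fun y => ∫ t in (1:ℝ)..y, g t) (g x) x := by
    intro x hx
    have hs : Set.uIcc 1 x ⊆ Set.Ioi 0 := by
      intro y hy
      exact (lt_min one_pos hx).trans_le hy.1
    apply intervalIntegral.integral_hasDerivAt_right
    · exact (hg.mono hs).intervalIntegrable
    · exact hg.stronglyMeasurableAtFilter isOpen_Ioi x hx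
    · exact hg.continuousAt (Ioi_mem_nhds hx)
  have key : ∀ Y, X ≤ Y → ∫ x in X..Y, g x * x ^ (-a) ≤ (A + a * A / (a - p)) * X ^ (p - a) := by
    intro Y hY
    have hY0 : 0 < Y := hX0.trans_le hY
    set M := fun y => ∫ t in (1:ℝ)..y, g t with hMdef
    have hM0 : ∀ y, 1 ≤ y → 0 ≤ M y := fun y hy => intervalIntegral.integral_nonneg hy (fun x _ => hg0 x)
    have hMc : ContinuousOn M (Set.uIcc X Y) := fun x hx =>
      (hder x (hsub Y hY hx)).continuousAt.continuousWithinAt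
    have hci : ∀ c : ℝ, ContinuousOn (fun x : ℝ => x ^ c) (Set.uIcc X Y) := fun c =>
      continuousOn_id.rpow_const (fun x hx => Or.inl (ne_of_gt (hsub Y hY hx)))
    have ibp := intervalIntegral.integral_mul_deriv_eq_deriv_mul (a := X) (b := Y)
      (u := fun x => x ^ (-a)) (u' := fun x => (-a) * x ^ (-a - 1)) (v := M) (v' := g)
      (fun x hx => Real.hasDerivAt_rpow_const (Or.inl (ne_of_gt (hsub Y hY hx))))
      (fun x hx => hder x (hsub Y hY hx))
      ((continuousOn_const.mul (hci _)).intervalIntegrable)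
      ((hg.mono (hsub Y hY)).intervalIntegrable)
    have e1 : ∫ x in X..Y, g x * x ^ (-a) = ∫ x in X..Y, x ^ (-a) * g x := by
      simp_rw [mul_comm]
    have b1 : -∫ x in X..Y, (-a) * x ^ (-a - 1) * M x ≤ ∫ x in X..Y, a * A * x ^ (p - a - 1) := by
      rw [← intervalIntegral.integral_neg]
      apply intervalIntegral.integral_mono_on hY
      · exact (((continuousOn_const.mul (hci _)).mul hMc).neg).intervalIntegrable
      · exact (continuousOn_const.mul (hci _)).intervalIntegrable
      · intro x hx
        have hx0 : 0 < x := hX0.trans_le hx.1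
        have h3 := hM x (hX.trans hx.1)
        have h4 : x ^ (p - a - 1) = x ^ (-a - 1) * x ^ p := by
          rw [← Real.rpow_add hx0]; ring_nf
        rw [h4]
        have h5 : 0 ≤ a * x ^ (-a - 1) := by positivity
        have := mul_le_mul_of_nonneg_left h3 h5
        simp only [hMdef]
        linarith
    have b2 : ∫ x in X..Y, a * A * x ^ (p - a - 1) ≤ a * A / (a - p) * X ^ (p - a) := by
      rw [intervalIntegral.integral_const_mul, integral_rpow (Or.inr ⟨by linarith, fun h => lt_irrefl (0:ℝ) (hsub Y hY h)⟩)]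
      have : 0 < a - p := by linarith
      have h6 : (Y ^ (p - a - 1 + 1) - X ^ (p - a - 1 + 1)) / (p - a - 1 + 1) = (X ^ (p - a) - Y ^ (p - a)) / (a - p) := by
        rw [sub_add_cancel, ← neg_sub a p, div_neg, ← neg_div]; ring_nf
      rw [h6, div_mul_eq_mul_div, mul_div_assoc]
      have : 0 ≤ Y ^ (p - a) := by positivity
      gcongr
      linarith
    have b3 : Y ^ (-a) * M Y ≤ A * X ^ (p - a) := by
      calc Y ^ (-a) * M Y ≤ Y ^ (-a) * (A * Y ^ p) := by
            gcongr; exact hM Y (hX.trans hY)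
        _ = A * Y ^ (p - a) := by
            rw [mul_left_comm, ← Real.rpow_add hY0]; ring_nf
        _ ≤ A * X ^ (p - a) := by
            gcongr A * ?_
            exact Real.rpow_le_rpow_of_nonpos hX0 hY (by linarith)
    have b4 : 0 ≤ X ^ (-a) * M X := mul_nonneg (by positivity) (hM0 X (by linarith))
    rw [e1, ibp]
    linarith
  have hint : IntegrableOn (fun x => g x * x ^ (-a)) (Set.Ioi X) := by
    refine integrableOn_Ioi_of_intervalIntegral_norm_bounded (b := fun y : ℝ => y) (l := Filter.atTop)
      ((A + a * A / (a - p)) * X ^ (p - a)) X (fun Y => ?_) Filter.tendsto_id ?_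
    · rcases le_total X Y with h | h
      · rw [← intervalIntegrable_iff_integrableOn_Ioc_of_le h]
        exact (hcont.mono (hsub Y h)).intervalIntegrable
      · simp [Set.Ioc_eq_empty (not_lt.2 h)]
    · filter_upwards [Filter.eventually_ge_atTop X] with Y hY
      refine le_trans (le_of_eq ?_) (key Y hY)
      apply intervalIntegral.integral_congr
      intro x hx
      have : 0 < x := hsub Y hY hx
      exact Real.norm_of_nonneg (mul_nonneg (hg0 x) (by positivity))
  refine ⟨hint, ?_⟩
  refine le_of_tendsto (intervalIntegral_tendsto_integral_Ioi X hint Filter.tendsto_id) ?_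
  filter_upwards [Filter.eventually_ge_atTop X] with Y hY
  exact key Y hY

theorem stmt_18
    (P4 : Polynomial ℝ) (hdeg : P4.degree = 4)
    (hlead : P4.leadingCoeff = 1 / (2 * Real.pi ^ 2))
    (E2 : ℝ → ℝ)
    (hE2 : ∀ T : ℝ, E2 T =
      (∫ t in (0:ℝ)..T, ‖riemannZeta (1/2 + Complex.I * t)‖ ^ 4)
        - T * P4.eval (Real.log T))
    (hpt : ∀ ε > 0, ∃ C > 0, ∀ T : ℝ, 2 ≤ T → |E2 T| ≤ C * T ^ ((2:ℝ)/3 + ε))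
    (hms : ∃ C > 0, ∃ A > 0, ∀ T : ℝ, 2 ≤ T →
      (∫ t in (1:ℝ)..T, (E2 t) ^ 2) ≤ A * T ^ 2 * Real.log T ^ C)
    (σ : ℝ) (hσ : 7/6 < σ) (ε : ℝ) (hε : 0 < ε) :
    ∃ C > 0, ∀ X : ℝ, 2 ≤ X → ∀ T : ℝ, 2 ≤ T →
      (∫ t in T..(2 * T),
        ‖((σ : ℂ) + Complex.I * t) *
            ∫ x in Set.Ioi X, (((E2 x) ^ 2 : ℝ) : ℂ)
              * (x : ℂ) ^ (-(σ : ℂ) - 1 - Complex.I * t)‖ ^ 2)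
        ≤ C * T ^ 2 * X ^ ((7:ℝ)/3 - 2 * σ + ε) := by
  have hzc : Continuous (fun t : ℝ => ‖riemannZeta (1/2 + Complex.I * t)‖ ^ 4) := by
    refine (Continuous.norm ?_).pow 4
    rw [continuous_iff_continuousAt]
    intro t
    have hne : (1/2 + Complex.I * t : ℂ) ≠ 1 := by
      intro h
      have := congrArg Complex.re h
      norm_num at this
    exact ContinuousAt.comp (f := fun t : ℝ => (1/2 + Complex.I * t : ℂ))
      (differentiableAt_riemannZeta hne).continuousAt (by fun_prop)
  have hEc : ContinuousOn E2 (Set.Ioi 0) := by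
    have h1 : Continuous (fun T : ℝ => ∫ t in (0:ℝ)..T, ‖riemannZeta (1/2 + Complex.I * t)‖ ^ 4) :=
      intervalIntegral.continuous_primitive (fun a b => hzc.intervalIntegrable a b) 0
    have h2 : ContinuousOn (fun T : ℝ => T * P4.eval (Real.log T)) (Set.Ioi 0) := by
      refine continuousOn_id.mul (P4.continuous.comp_continuousOn ?_)
      exact Real.continuousOn_log.mono (fun x hx => ne_of_gt hx)
    exact (h1.continuousOn.sub h2).congr (fun T _ => hE2 T)
  obtain ⟨δ, hδ, hδ1, hδ2⟩ : ∃ δ > 0, 3 * δ ≤ ε ∧ 3 * δ < 2 * σ - 7/3 := by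
    refine ⟨min ε (2 * σ - 7/3) / 4, ?_, ?_, ?_⟩
    · have : 0 < min ε (2 * σ - 7/3) := lt_min hε (by linarith)
      positivity
    · have := min_le_left ε (2 * σ - 7/3); linarith
    · have := min_le_right ε (2 * σ - 7/3); linarith
  obtain ⟨B, hB, hBd⟩ := hpt δ hδ
  obtain ⟨n, hn, A, hA, hms⟩ := hms
  have hn' : (0:ℝ) < n := by exact_mod_cast hn
  obtain ⟨A', hA', hM⟩ : ∃ A' > 0, ∀ T : ℝ, 2 ≤ T →
      ∫ t in (1:ℝ)..T, (E2 t) ^ 2 ≤ A' * T ^ (2 + δ) := by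
    refine ⟨A * (n / δ) ^ n, by positivity, fun T hT => (hms T hT).trans ?_⟩
    have hT0 : 0 < T := by linarith
    have hl : Real.log T ≤ T ^ (δ / n) / (δ / n) := Real.log_le_rpow_div hT0.le (by positivity)
    have hl0 : 0 ≤ Real.log T := Real.log_nonneg (by linarith)
    calc A * T ^ 2 * Real.log T ^ n ≤ A * T ^ 2 * (T ^ (δ / n) / (δ / n)) ^ n := by gcongr
      _ = A * (n / δ) ^ n * T ^ (2 + δ) := by
        rw [Real.rpow_add hT0, Real.rpow_two, div_pow, ← Real.rpow_mul_natCast hT0.le,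
          div_mul_cancel₀ _ hn'.ne', div_pow, div_pow]
        field_simp
  have tail := fun a ha X hX => tail_aux (fun x => E2 x ^ 2) (hEc.pow 2) (fun x => sq_nonneg _)
    A' (2 + δ) a hA' (by linarith) ha hM X hX
  set a : ℝ := 2 * σ + 1 - 4/3 - 2 * δ with ha
  have hpa : 2 + δ < a := by rw [ha]; linarith
  set D : ℝ := A' + a * A' / (a - (2 + δ)) with hD
  have hD0 : 0 < D := by
    have h1 : 0 < a := by linarith
    have h2 : 0 < a - (2 + δ) := by linarith
    positivity
  refine ⟨(σ ^ 2 + 4) * (2 * Real.pi * (B ^ 2 * D)), by positivity, fun X hX T hT => ?_⟩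
  have hX0 : 0 < X := by linarith
  obtain ⟨t1, t2⟩ := tail a hpa X hX
  have i1 : IntegrableOn (fun x => E2 x ^ 2 * x ^ (-σ - 1)) (Set.Ioi X) := by
    have := (tail (σ + 1) (by linarith) X hX).1
    rwa [neg_add'] at this
  have hle : ∀ x ∈ Set.Ioi X, (E2 x ^ 2) ^ 2 * x ^ (-2 * σ - 1) ≤ B ^ 2 * (E2 x ^ 2 * x ^ (-a)) := by
    intro x hx
    have hx2 : 2 ≤ x := hX.trans (le_of_lt hx)
    have hx0 : 0 < x := by linarith
    have h1 := hBd x hx2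
    have h2 : E2 x ^ 2 ≤ (B * x ^ ((2:ℝ)/3 + δ)) ^ 2 := by
      rw [← sq_abs]; gcongr
    have h3 : x ^ (-a) = (x ^ ((2:ℝ)/3 + δ)) ^ 2 * x ^ (-2 * σ - 1) := by
      rw [← Real.rpow_mul_natCast hx0.le, ← Real.rpow_add hx0, ha]
      congr 1
      push_cast
      ring
    rw [h3]
    have h4 : 0 ≤ E2 x ^ 2 * x ^ (-2 * σ - 1) := by positivity
    have := mul_le_mul_of_nonneg_right h2 h4
    nlinarith [this]
  have hc4 : ContinuousOn (fun x => (E2 x ^ 2) ^ 2 * x ^ (-2 * σ - 1)) (Set.Ioi X) := by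
    have hs : Set.Ioi X ⊆ Set.Ioi 0 := Set.Ioi_subset_Ioi hX0.le
    exact (((hEc.mono hs).pow 2).pow 2).mul
      (continuousOn_id.rpow_const (fun x hx => Or.inl (ne_of_gt (hs hx))))
  have i2 : IntegrableOn (fun x => (E2 x ^ 2) ^ 2 * x ^ (-2 * σ - 1)) (Set.Ioi X) := by
    refine Integrable.mono' (t1.const_mul (B ^ 2)) (hc4.aestronglyMeasurable measurableSet_Ioi) ?_
    filter_upwards [ae_restrict_mem measurableSet_Ioi] with x hx
    have hx0 : 0 < x := hX0.trans hx
    rw [Real.norm_of_nonneg (by positivity)]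
    exact hle x hx
  have v2 : ∫ x in Set.Ioi X, (E2 x ^ 2) ^ 2 * x ^ (-2 * σ - 1) ≤ B ^ 2 * (D * X ^ (2 + δ - a)) := by
    calc _ ≤ ∫ x in Set.Ioi X, B ^ 2 * (E2 x ^ 2 * x ^ (-a)) :=
          setIntegral_mono_on i2 (t1.const_mul _) measurableSet_Ioi hle
      _ = B ^ 2 * ∫ x in Set.Ioi X, (E2 x ^ 2 * x ^ (-a)) := integral_const_mul _ _
      _ ≤ _ := by gcongr
  obtain ⟨q1, q2⟩ := mp_aux (fun x => E2 x ^ 2) σ X hX0 i1 i2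
  have hT0 : 0 < T := by linarith
  set G : ℝ → ℂ := fun t => ∫ x in Set.Ioi X, (((E2 x) ^ 2 : ℝ) : ℂ)
              * (x : ℂ) ^ (-(σ : ℂ) - 1 - Complex.I * t) with hG
  have hpos : 0 ≤ ∫ t : ℝ, ‖G t‖ ^ 2 := integral_nonneg (fun t => by positivity)
  have hs : ∀ t : ℝ, ‖((σ : ℂ) + Complex.I * t) * G t‖ ^ 2 = (σ ^ 2 + t ^ 2) * ‖G t‖ ^ 2 := by
    intro t
    rw [norm_mul, mul_pow, ← Complex.normSq_eq_norm_sq]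
    congr 1
    simp [Complex.normSq_apply]
    ring
  calc (∫ t in T..(2 * T), ‖((σ : ℂ) + Complex.I * t) * G t‖ ^ 2)
      = ∫ t in T..(2 * T), (σ ^ 2 + t ^ 2) * ‖G t‖ ^ 2 := by simp_rw [hs]
    _ ≤ ∫ t in T..(2 * T), (σ ^ 2 + 4) * T ^ 2 * ‖G t‖ ^ 2 := by
        have hi : IntervalIntegrable (fun t => ‖G t‖ ^ 2) volume T (2 * T) := q1.intervalIntegrable
        apply intervalIntegral.integral_mono_on (by linarith)
        · exact hi.continuousOn_mul (by fun_prop)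
        · exact hi.const_mul _
        · intro t ht
          have h1 : t ^ 2 ≤ (2 * T) ^ 2 := by
            have h0 : 0 ≤ t := hT0.le.trans ht.1
            exact pow_le_pow_left₀ h0 ht.2 2
          have h2 : σ ^ 2 ≤ σ ^ 2 * T ^ 2 := by
            have : 1 ≤ T ^ 2 := by nlinarith
            nlinarith [sq_nonneg σ]
          gcongr
          linarith
    _ = (σ ^ 2 + 4) * T ^ 2 * ∫ t in T..(2 * T), ‖G t‖ ^ 2 := intervalIntegral.integral_const_mul _ _
    _ ≤ (σ ^ 2 + 4) * T ^ 2 * ∫ t : ℝ, ‖G t‖ ^ 2 := by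
        gcongr
        rw [intervalIntegral.integral_of_le (by linarith)]
        exact setIntegral_le_integral q1 (Filter.Eventually.of_forall (fun t => by positivity))
    _ ≤ (σ ^ 2 + 4) * T ^ 2 * (2 * Real.pi * (B ^ 2 * (D * X ^ (2 + δ - a)))) := by
        rw [q2]; gcongr
    _ ≤ (σ ^ 2 + 4) * T ^ 2 * (2 * Real.pi * (B ^ 2 * (D * X ^ ((7:ℝ)/3 - 2 * σ + ε)))) := by
        gcongr
        · linarith
        · rw [ha]; linarith
    _ = _ := by ring
end
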